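/- arXiv:math/0701266 — 3 statements merged into one kernel-verified Lean document; each statement's English description precedes it below -/
import Mathlib

section
/- Let G ⊂ GL(V) be an irreducible complex reflection group with set of reflections R, and let φ be an automorphism of G which maps R into R·Z(G). If either dim V ≥ 3, or G has the property that any two orthogonal reflecting hyperplanes of G are conjugate under G, then φ ∈ C·A, i.e. φ is the product of a central automorphism and an automorphism preserving R. -/
open Module LinearMap

section Defs

variable {𝕜 V : Type*} [Field 𝕜] [AddCommGroup V] [Module 𝕜 V]

/-- A (pseudo)reflection: a nontrivial finite-order linear automorphism
whose fixed subspace is a hyperplane. -/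
def IsPseudoReflection (g : V ≃ₗ[𝕜] V) : Prop :=
  IsOfFinOrder g ∧ g ≠ 1 ∧
    Module.finrank 𝕜 (LinearMap.ker ((g : V →ₗ[𝕜] V) - LinearMap.id)) + 1 = Module.finrank 𝕜 V

/-- The set of reflections of a linear group. -/
def reflectionsOf (G : Subgroup (V ≃ₗ[𝕜] V)) : Set (V ≃ₗ[𝕜] V) :=
  {g | g ∈ G ∧ IsPseudoReflection g}

/-- A reflection group: a finite linear group generated by its reflections. -/
def IsReflectionGroup (G : Subgroup (V ≃ₗ[𝕜] V)) : Prop :=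
  Finite G ∧ Subgroup.closure (reflectionsOf G) = G

/-- The group `G` acts irreducibly on `V`. -/
def ActsIrreducibly (G : Subgroup (V ≃ₗ[𝕜] V)) : Prop :=
  Nontrivial V ∧
    ∀ W : Submodule 𝕜 V, (∀ g ∈ G, W.map ((g : V ≃ₗ[𝕜] V) : V →ₗ[𝕜] V) ≤ W) → W = ⊥ ∨ W = ⊤

/-- A central automorphism: `α g ∈ g · Z(H)` for every `g`. -/
def IsCentralAut {H : Type*} [Group H] (α : MulAut H) : Prop :=
  ∀ g : H, g⁻¹ * α g ∈ Subgroup.center H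

/-- An automorphism of `G` preserving the set of reflections of `G`. -/
def PreservesReflections (G : Subgroup (V ≃ₗ[𝕜] V)) (α : MulAut ↥G) : Prop :=
  ∀ g : ↥G, IsPseudoReflection ((g : V ≃ₗ[𝕜] V)) ↔ IsPseudoReflection ((α g : V ≃ₗ[𝕜] V))

end Defs

open Pointwise

section Hyperplanes

variable {V : Type*} [AddCommGroup V] [Module ℂ V]

/-- The fixed subspace of a linear automorphism. -/
abbrev fixedSpace (g : V ≃ₗ[ℂ] V) : Submodule ℂ V :=
  LinearMap.ker ((g : V →ₗ[ℂ] V) - LinearMap.id)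

lemma mem_fixedSpace {g : V ≃ₗ[ℂ] V} {x : V} : x ∈ fixedSpace g ↔ g x = x := by
  simp [fixedSpace, LinearMap.mem_ker, sub_eq_zero]

lemma mem_smul_submodule {g : V ≃ₗ[ℂ] V} {W : Submodule ℂ V} {x : V} :
    x ∈ g • W ↔ g⁻¹ x ∈ W := by
  rw [Submodule.mem_smul_pointwise_iff_exists]
  constructor
  · rintro ⟨b, hb, rfl⟩
    simpa using hb
  · intro h
    exact ⟨_, h, by simp⟩

lemma finrank_smul_submodule (g : V ≃ₗ[ℂ] V) (W : Submodule ℂ V) :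
    finrank ℂ ↥(g • W) = finrank ℂ W :=
  LinearEquiv.finrank_map_eq g W

variable [FiniteDimensional ℂ V]

lemma exists_dual_ker_eq {W : Submodule ℂ V} (hW : finrank ℂ W + 1 = finrank ℂ V) :
    ∃ a : Dual ℂ V, LinearMap.ker a = W ∧ ∃ e, a e = 1 := by
  have hlt : W < ⊤ := by
    rw [lt_top_iff_ne_top]
    rintro rfl
    rw [finrank_top] at hW
    omega
  obtain ⟨a, ha, hle⟩ := Submodule.exists_le_ker_of_lt_top W hlt
  have hrank := Module.Dual.finrank_ker_add_one_of_ne_zero ha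
  refine ⟨a, (Submodule.eq_of_le_of_finrank_eq hle (by omega)).symm, ?_⟩
  obtain ⟨v, hv⟩ : ∃ v, a v ≠ 0 := by
    by_contra! h
    exact ha (LinearMap.ext h)
  exact ⟨(a v)⁻¹ • v, by simp [hv]⟩

lemma dual_apply_eq_det_mul {a : Dual ℂ V} {e : V} (he : a e = 1) {g : V ≃ₗ[ℂ] V}
    (hg : LinearMap.ker a ≤ fixedSpace g) (x : V) :
    a (g x) = LinearEquiv.det g * a x := by
  have key : ∀ y, g y = y + a y • (g e - e) := by
    intro y
    have hy : y - a y • e ∈ LinearMap.ker a := by simp [he]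
    have := mem_fixedSpace.1 (hg hy)
    rw [map_sub, map_smul] at this
    rw [smul_sub]
    rw [sub_eq_iff_eq_add] at this
    rw [this]
    abel
  have heq : (g : V →ₗ[ℂ] V) = LinearMap.transvection a (g e - e) := by
    ext y
    simpa [LinearMap.transvection.apply] using key y
  have hdet : ((LinearEquiv.det g : ℂˣ) : ℂ) = a (g e) := by
    rw [LinearEquiv.coe_det, heq, LinearMap.transvection.det, map_sub, he]
    ring
  rw [key x, map_add, map_smul, map_sub, he, hdet, smul_eq_mul]
  ring

lemma eq_one_of_det_eq_one {W : Submodule ℂ V} (hW : finrank ℂ W + 1 = finrank ℂ V)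
    {g : V ≃ₗ[ℂ] V} (hg : W ≤ fixedSpace g) (hfin : IsOfFinOrder g)
    (hdet : LinearEquiv.det g = 1) : g = 1 := by
  obtain ⟨a, rfl, e, he⟩ := exists_dual_ker_eq hW
  have hinv : ∀ x, a (g x) = a x := fun x => by
    rw [dual_apply_eq_det_mul he hg, hdet, Units.val_one, one_mul]
  obtain ⟨n, hn, hpow⟩ := isOfFinOrder_iff_pow_eq_one.1 hfin
  ext x
  have hu : g (g x - x) = g x - x :=
    mem_fixedSpace.1 (hg (by rw [LinearMap.mem_ker, map_sub, hinv, sub_self]))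
  have hit : ∀ m : ℕ, (g ^ m) x = x + (m : ℂ) • (g x - x) := by
    intro m
    induction m with
    | zero => simp
    | succ k ih =>
      rw [pow_succ', LinearEquiv.mul_apply, ih, map_add, map_smul, hu]
      push_cast
      module
  have h := hit n
  rw [hpow, LinearEquiv.coe_one, id_eq, left_eq_add, smul_eq_zero] at h
  rcases h with h | h
  · exact absurd (Nat.cast_eq_zero.1 h) hn.ne'
  · simpa [sub_eq_zero] using h

lemma isPseudoReflection_of_le_fixedSpace {W : Submodule ℂ V}
    (hW : finrank ℂ W + 1 = finrank ℂ V) {g : V ≃ₗ[ℂ] V} (hg : W ≤ fixedSpace g)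
    (hfin : IsOfFinOrder g) (hne : g ≠ 1) : IsPseudoReflection g ∧ fixedSpace g = W := by
  have hlt : finrank ℂ (fixedSpace g) ≠ finrank ℂ V := by
    intro h
    apply hne
    have := Submodule.eq_top_of_finrank_eq h
    ext x
    exact mem_fixedSpace.1 (this ▸ Submodule.mem_top : x ∈ fixedSpace g)
  have h1 := Submodule.finrank_mono hg
  have h2 := Submodule.finrank_le (fixedSpace g)
  have h3 : finrank ℂ (fixedSpace g) = finrank ℂ W := by omega
  exact ⟨⟨hfin, hne, by rw [h3, hW]⟩, (Submodule.eq_of_le_of_finrank_eq hg h3.symm).symm⟩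

/-- The linear character attached to a `G`-orbit of hyperplanes: it agrees with the determinant
on reflections whose hyperplane belongs to the orbit, and is trivial on all other reflections. -/
theorem exists_orbit_character (G : Subgroup (V ≃ₗ[ℂ] V)) [Finite G] (W : Submodule ℂ V)
    (hW : finrank ℂ W + 1 = finrank ℂ V) :
    ∃ χ : G →* ℂˣ, ∀ s : G, ∀ U : Submodule ℂ V, finrank ℂ U + 1 = finrank ℂ V →
      U ≤ fixedSpace (s : V ≃ₗ[ℂ] V) →
      (U ∈ MulAction.orbit G W → χ s = LinearEquiv.det (s : V ≃ₗ[ℂ] V)) ∧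
      (U ∉ MulAction.orbit G W → χ s = 1) := by
  classical
  let O := MulAction.orbit G W
  have : Finite O := Set.finite_range _
  have := Fintype.ofFinite O
  have hO : ∀ K : O, finrank ℂ (K : Submodule ℂ V) + 1 = finrank ℂ V := by
    rintro ⟨_, g, rfl⟩
    exact (congrArg (· + 1) (finrank_smul_submodule (g : V ≃ₗ[ℂ] V) W)).trans hW
  choose a hker e he using fun K : O => exists_dual_ker_eq (hO K)
  have hact : ∀ (g : G) (K : O) (x : V), x ∈ ((g • K : O) : Submodule ℂ V) ↔
      ((g : V ≃ₗ[ℂ] V)⁻¹) x ∈ (K : Submodule ℂ V) := fun g K x => mem_smul_submodule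
  let c : G → O → ℂ := fun g K => a K ((g : V ≃ₗ[ℂ] V) (e (g⁻¹ • K)))
  have hc : ∀ (g : G) (K : O) (x : V), a K ((g : V ≃ₗ[ℂ] V) x) = c g K * a (g⁻¹ • K) x := by
    intro g K x
    have hx : x - a (g⁻¹ • K) x • e (g⁻¹ • K) ∈ LinearMap.ker (a (g⁻¹ • K)) := by simp [he]
    rw [hker, hact, ← hker, LinearMap.mem_ker] at hx
    simp only [InvMemClass.coe_inv, inv_inv, map_sub, map_smul, smul_eq_mul, sub_eq_zero] at hx
    rw [hx, mul_comm]
  have hcmul : ∀ (g h : G) (K : O), c (g * h) K = c g K * c h (g⁻¹ • K) := by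
    intro g h K
    change a K ((g : V ≃ₗ[ℂ] V) ((h : V ≃ₗ[ℂ] V) (e ((g * h)⁻¹ • K)))) = _
    rw [hc, hc, mul_inv_rev, mul_smul, he, mul_one]
  let χ : G →* ℂ :=
    { toFun := fun g => ∏ K, c g K
      map_one' := by
        refine Finset.prod_eq_one fun K _ => ?_
        simp [c, he]
      map_mul' := fun g h => by
        simp only [hcmul, Finset.prod_mul_distrib]
        congr 1
        exact Equiv.prod_comp (MulAction.toPerm g⁻¹) (fun K => c h K) }
  refine ⟨χ.toHomUnits, fun s U hU hs => ?_⟩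
  -- the factors away from the fixed hyperplane multiply to one
  have hprod : ∏ K ∈ Finset.univ.filter (fun K : O => (K : Submodule ℂ V) ≠ U), c s K = 1 := by
    have hsU : ∀ K : O, ((s⁻¹ • K : O) : Submodule ℂ V) = U ↔ (K : Submodule ℂ V) = U := by
      have hfix : s • U = U := by
        apply Submodule.eq_of_le_of_finrank_eq
        · intro x hx
          obtain ⟨y, hy, rfl⟩ := (Submodule.mem_smul_pointwise_iff_exists _ (s : V ≃ₗ[ℂ] V) _).1 hx
          have hy' : (s : V ≃ₗ[ℂ] V) • y = y := mem_fixedSpace.1 (hs hy)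
          rwa [hy']
        · exact finrank_smul_submodule _ _
      intro K
      rw [MulAction.orbit.coe_smul, inv_smul_eq_iff, hfix]
    obtain ⟨x, hxU, hx⟩ := Module.Dual.exists_forall_mem_ne_zero_of_forall_exists U
      (fun K : {K : O // (K : Submodule ℂ V) ≠ U} => a K.1) (by
        rintro ⟨K, hK⟩
        by_contra! h
        apply hK
        have hle : U ≤ K := fun x hx => by
          rw [← hker, LinearMap.mem_ker]
          exact h x hx
        exact (Submodule.eq_of_le_of_finrank_eq hle (by have := hO K; omega)).symm)
    have hxs : ∀ K, a K x = c s K * a (s⁻¹ • K) x := fun K => by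
      rw [← hc, mem_fixedSpace.1 (hs hxU)]
    have h1 : ∏ K ∈ Finset.univ.filter (fun K : O => (K : Submodule ℂ V) ≠ U), a K x =
        (∏ K ∈ Finset.univ.filter (fun K : O => (K : Submodule ℂ V) ≠ U), c s K) *
        ∏ K ∈ Finset.univ.filter (fun K : O => (K : Submodule ℂ V) ≠ U), a K x := by
      conv_lhs => rw [Finset.prod_congr rfl fun K _ => hxs K, Finset.prod_mul_distrib]
      congr 1
      refine Finset.prod_equiv (MulAction.toPerm s⁻¹) (fun K => ?_) (fun K _ => rfl)
      simp only [Finset.mem_filter, Finset.mem_univ, true_and, MulAction.toPerm_apply, ne_eq, hsU]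
    refine (mul_eq_right₀ ?_).1 h1.symm
    exact Finset.prod_ne_zero_iff.2 fun K hK => hx ⟨K, (Finset.mem_filter.1 hK).2⟩
  have hsplit := Finset.prod_filter_mul_prod_filter_not Finset.univ
    (fun K : O => (K : Submodule ℂ V) = U) (c s)
  rw [show (∏ K ∈ Finset.univ.filter (fun K : O => ¬ (K : Submodule ℂ V) = U), c s K) = 1 from
    hprod, mul_one] at hsplit
  have hval : ((χ.toHomUnits s : ℂˣ) : ℂ) = ∏ K, c s K := rfl
  refine ⟨fun hmem => Units.ext ?_, fun hmem => Units.ext ?_⟩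
  · rw [hval, ← hsplit, Finset.prod_eq_single (⟨U, hmem⟩ : O)]
    · have h := dual_apply_eq_det_mul (he ⟨U, hmem⟩) (g := s) (by rw [hker]; exact hs)
        (e (s⁻¹ • ⟨U, hmem⟩))
      have hinv : (s⁻¹ • ⟨U, hmem⟩ : O) = ⟨U, hmem⟩ := by
        rw [inv_smul_eq_iff]
        apply Subtype.ext
        refine Submodule.eq_of_le_of_finrank_eq (fun x hx => ?_) (finrank_smul_submodule _ _).symm
        refine (hact s _ x).2 ?_
        have hx' := mem_fixedSpace.1 (hs hx)
        rw [← hx']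
        simpa using hx
      change a _ ((s : V ≃ₗ[ℂ] V) _) = _
      rw [h, hinv, he, mul_one]
    · intro K hK hne
      exact absurd (Subtype.ext (Finset.mem_filter.1 hK).2) hne
    · intro h
      exact (h (by simp)).elim
  · rw [hval, ← hsplit, Units.val_one]
    refine Finset.prod_eq_one fun K hK => ?_
    exact absurd ((Finset.mem_filter.1 hK).2 ▸ K.2) hmem

end Hyperplanes

section ReflectionGroups

variable {V : Type*} [AddCommGroup V] [Module ℂ V]

/-- Homotheties, as linear automorphisms. -/
abbrev homothety : ℂˣ →* (V ≃ₗ[ℂ] V) := DistribMulAction.toModuleAut ℂ V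

lemma homothety_apply (c : ℂˣ) (x : V) : (homothety c : V ≃ₗ[ℂ] V) x = (c : ℂ) • x := rfl

lemma mem_center_of_eq_homothety {G : Subgroup (V ≃ₗ[ℂ] V)} {z : G} {c : ℂˣ}
    (hz : (z : V ≃ₗ[ℂ] V) = homothety c) : z ∈ Subgroup.center G := by
  rw [Subgroup.mem_center_iff]
  intro g
  apply Subtype.ext
  ext x
  rw [Subgroup.coe_mul, Subgroup.coe_mul, LinearEquiv.mul_apply, LinearEquiv.mul_apply, hz,
    homothety_apply, homothety_apply, map_smul]

lemma eq_top_of_reflections_mem {G : Subgroup (V ≃ₗ[ℂ] V)} (hG : IsReflectionGroup G)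
    {K : Subgroup G} (hK : ∀ s : G, IsPseudoReflection (s : V ≃ₗ[ℂ] V) → s ∈ K) : K = ⊤ := by
  have hle : G ≤ K.map G.subtype := by
    conv_lhs => rw [← hG.2]
    rw [Subgroup.closure_le]
    exact fun s hs => ⟨⟨s, hs.1⟩, hK ⟨s, hs.1⟩ hs.2, rfl⟩
  rw [eq_top_iff]
  intro g _
  obtain ⟨k, hk, hkg⟩ := hle g.2
  rwa [← Subtype.ext hkg]

lemma IsPseudoReflection.exists_fixed {g : V ≃ₗ[ℂ] V} (hg : IsPseudoReflection g)
    (hV : 2 ≤ finrank ℂ V) : ∃ x : V, x ≠ 0 ∧ g x = x := by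
  have hne : fixedSpace g ≠ ⊥ := by
    intro h
    have := hg.2.2
    rw [show LinearMap.ker ((g : V →ₗ[ℂ] V) - LinearMap.id) = ⊥ from h, finrank_bot] at this
    omega
  obtain ⟨x, hx, hx0⟩ := Submodule.exists_mem_ne_zero_of_ne_bot hne
  exact ⟨x, hx0, mem_fixedSpace.1 hx⟩

/-- In a plane, if reflections `s = c • t` differ by a nontrivial homothety, their axes are
distinct, and orthogonal for every hermitian form preserved by `s`. -/
lemma orthogonal_of_eq_homothety_mul {s t : V ≃ₗ[ℂ] V} {c : ℂˣ} (hc : c ≠ 1)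
    (hst : s = homothety c * t) (hsup : fixedSpace s ⊔ fixedSpace t = ⊤)
    {B : V → V → ℂ} (hlin : ∀ v : V, IsLinearMap ℂ (B v))
    (hsemi : ∀ (w : V) (a : ℂ) (v v' : V),
      B (a • v + v') w = starRingEnd ℂ a * B v w + B v' w)
    (hinv : ∀ v w : V, B (s v) (s w) = B v w) (hpos : ∀ v : V, v ≠ 0 → 0 < (B v v).re)
    {v w : V} (hv : ∀ x ∈ fixedSpace s, B v x = 0) (hw : ∀ x ∈ fixedSpace t, B w x = 0) :
    B v w = 0 := by
  have horth : ∀ x ∈ fixedSpace s, ∀ y ∈ fixedSpace t, B x y = 0 := by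
    intro x hx y hy
    have hsy : s y = (c : ℂ) • y := by
      rw [hst, LinearEquiv.mul_apply, mem_fixedSpace.1 hy, homothety_apply]
    have h := hinv x y
    rw [mem_fixedSpace.1 hx, hsy, (hlin x).map_smul, smul_eq_mul, mul_left_eq_self₀] at h
    exact h.resolve_left fun h => hc (Units.val_eq_one.1 h)
  have hadd : ∀ x y z, B (x + y) z = B x z + B y z := fun x y z => by
    simpa using hsemi z 1 x y
  have hzero : ∀ x, B x x = 0 → x = 0 := fun x hx => by
    by_contra h
    simpa [hx] using hpos x h
  obtain ⟨x, hx, y, hy, rfl⟩ := Submodule.mem_sup.1 (hsup ▸ Submodule.mem_top :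
    w ∈ fixedSpace s ⊔ fixedSpace t)
  have hy0 : y = 0 := hzero y <| by
    have := hw y hy
    rwa [hadd, horth x hx y hy, zero_add] at this
  rw [hy0, add_zero]
  exact hv x hx

variable [FiniteDimensional ℂ V]

lemma ActsIrreducibly.exists_eq_homothety {G : Subgroup (V ≃ₗ[ℂ] V)} (hirr : ActsIrreducibly G)
    {z : G} (hz : z ∈ Subgroup.center G) : ∃ c : ℂˣ, (z : V ≃ₗ[ℂ] V) = homothety c := by
  have := hirr.1
  obtain ⟨c, hc⟩ := Module.End.exists_eigenvalue ((z : V ≃ₗ[ℂ] V) : V →ₗ[ℂ] V)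
  have htop : Module.End.eigenspace ((z : V ≃ₗ[ℂ] V) : V →ₗ[ℂ] V) c = ⊤ := by
    refine (hirr.2 _ ?_).resolve_left hc
    rintro g hg _ ⟨x, hx, rfl⟩
    have hx' := Module.End.mem_eigenspace_iff.1 hx
    have hcomm := congrArg (fun h : G => (h : V ≃ₗ[ℂ] V) x)
      (Subgroup.mem_center_iff.1 hz ⟨g, hg⟩)
    rw [Module.End.mem_eigenspace_iff]
    simp only [Subgroup.coe_mul, LinearEquiv.mul_apply, LinearEquiv.coe_coe] at hcomm hx' ⊢
    rw [← hcomm, hx', map_smul]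
  have happ : ∀ x, (z : V ≃ₗ[ℂ] V) x = c • x := fun x =>
    Module.End.mem_eigenspace_iff.1 (htop ▸ Submodule.mem_top :
      x ∈ Module.End.eigenspace ((z : V ≃ₗ[ℂ] V) : V →ₗ[ℂ] V) c)
  have hc0 : c ≠ 0 := by
    rintro rfl
    obtain ⟨x, hx⟩ := exists_ne (0 : V)
    exact hx ((z : V ≃ₗ[ℂ] V).map_eq_zero_iff.1 (by rw [happ, zero_smul]))
  exact ⟨Units.mk0 c hc0, LinearEquiv.ext happ⟩

lemma ActsIrreducibly.eq_one_of_fixes {G : Subgroup (V ≃ₗ[ℂ] V)} (hirr : ActsIrreducibly G)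
    {z : G} (hz : z ∈ Subgroup.center G) {x : V} (hx0 : x ≠ 0)
    (hx : (z : V ≃ₗ[ℂ] V) x = x) : z = 1 := by
  obtain ⟨c, hc⟩ := hirr.exists_eq_homothety hz
  rw [hc, homothety_apply] at hx
  have h1 : (c : ℂ) = 1 := smul_left_injective ℂ hx0 (by simpa using hx)
  apply Subtype.ext
  rw [hc, Units.val_eq_one.1 h1, map_one, Subgroup.coe_one]

/-- For one orbit of reflecting hyperplanes, there is a linear character which records the central
parts of the images of the reflections about these hyperplanes, trivial on other reflections. -/
lemma exists_orbit_central_character {G : Subgroup (V ≃ₗ[ℂ] V)} [Finite G]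
    (hirr : ActsIrreducibly G) (hV : 2 ≤ finrank ℂ V) (φ : MulAut G)
    (hR : ∀ g : G, IsPseudoReflection (g : V ≃ₗ[ℂ] V) →
      ∃ s z : G, IsPseudoReflection (s : V ≃ₗ[ℂ] V) ∧ z ∈ Subgroup.center G ∧ φ g = s * z)
    {s₀ : G} (hs₀ : IsPseudoReflection (s₀ : V ≃ₗ[ℂ] V)) :
    ∃ ψ : G →* ℂˣ, ∀ s : G, IsPseudoReflection (s : V ≃ₗ[ℂ] V) →
      (fixedSpace (s : V ≃ₗ[ℂ] V) ∈ MulAction.orbit G (fixedSpace (s₀ : V ≃ₗ[ℂ] V)) →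
        ∃ r z : G, IsPseudoReflection (r : V ≃ₗ[ℂ] V) ∧
          (z : V ≃ₗ[ℂ] V) = homothety (ψ s) ∧ φ s = r * z) ∧
      (fixedSpace (s : V ≃ₗ[ℂ] V) ∉ MulAction.orbit G (fixedSpace (s₀ : V ≃ₗ[ℂ] V)) →
        ψ s = 1) := by
  set W := fixedSpace (s₀ : V ≃ₗ[ℂ] V) with hWdef
  have hW : finrank ℂ W + 1 = finrank ℂ V := hs₀.2.2
  let P : Subgroup G := fixingSubgroup G (W : Set V)
  have hP : ∀ g : G, g ∈ P ↔ W ≤ fixedSpace (g : V ≃ₗ[ℂ] V) := fun g => by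
    rw [mem_fixingSubgroup_iff]
    exact forall₂_congr fun x _ => mem_fixedSpace.symm
  have hfinG : ∀ g : G, IsOfFinOrder (g : V ≃ₗ[ℂ] V) := fun g =>
    G.subtype.isOfFinOrder (isOfFinOrder_of_finite g)
  let δ : P →* ℂˣ := LinearEquiv.det.comp (G.subtype.comp P.subtype)
  have hδ : Function.Injective δ := by
    rw [injective_iff_map_eq_one]
    intro g hg
    exact Subtype.ext (Subtype.ext (eq_one_of_det_eq_one hW ((hP g).1 g.2) (hfinG g) hg))
  have : IsCyclic P := isCyclic_of_injective_ringHom ((Units.coeHom ℂ).comp δ)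
    (Units.val_injective.comp hδ)
  obtain ⟨t, ht⟩ := IsCyclic.exists_generator (α := P)
  have ht1 : t ≠ 1 := by
    rintro rfl
    have h := ht ⟨s₀, (hP s₀).2 le_rfl⟩
    rw [Subgroup.zpowers_one_eq_bot, Subgroup.mem_bot] at h
    exact hs₀.2.1 (congrArg (fun g : P => ((g : G) : V ≃ₗ[ℂ] V)) h)
  have htR := (isPseudoReflection_of_le_fixedSpace hW ((hP t).1 t.2) (hfinG t)
    (fun h => ht1 (Subtype.ext (Subtype.ext h)))).1
  obtain ⟨r, z, hr, hz, hφt⟩ := hR t htR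
  obtain ⟨μ, hμ⟩ := hirr.exists_eq_homothety hz
  have hcomm : Commute r z := Subgroup.mem_center_iff.1 hz r
  -- the central part of the image of the generator is a power of its determinant
  have hμpow : μ ∈ Subgroup.zpowers (δ t) := by
    have hne : NeZero (orderOf t) := ⟨(orderOf_pos t).ne'⟩
    have hprim : IsPrimitiveRoot (δ t) (orderOf t) := by
      rw [← orderOf_injective δ hδ t]
      exact IsPrimitiveRoot.orderOf _
    rw [hprim.zpowers_eq, mem_rootsOfUnity]
    have h1 : r ^ orderOf t * z ^ orderOf t = 1 := by
      rw [← hcomm.mul_pow, ← hφt, ← map_pow, ← Subgroup.coe_pow, pow_orderOf_eq_one,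
        Subgroup.coe_one, map_one]
    obtain ⟨x, hx0, hx⟩ := hr.exists_fixed hV
    have hzx : ((z ^ orderOf t : G) : V ≃ₗ[ℂ] V) x = x := by
      rw [← inv_eq_of_mul_eq_one_right h1, Subgroup.coe_inv, Subgroup.coe_pow]
      have hx' : (r : V ≃ₗ[ℂ] V) ^ orderOf t ∈ MulAction.stabilizer (V ≃ₗ[ℂ] V) x :=
        pow_mem (MulAction.mem_stabilizer_iff.2 hx) _
      exact MulAction.mem_stabilizer_iff.1 (inv_mem hx')
    rw [Subgroup.coe_pow, hμ, ← map_pow, homothety_apply] at hzx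
    exact Units.val_eq_one.1 (smul_left_injective ℂ hx0 (by simpa using hzx))
  obtain ⟨k, hk⟩ := Subgroup.mem_zpowers_iff.1 hμpow
  obtain ⟨χ, hχ⟩ := exists_orbit_character G W hW
  have hψt : (χ ^ k) (t : G) = μ := by
    rw [MonoidHom.zpow_apply, (hχ t W hW ((hP t).1 t.2)).1 (MulAction.mem_orbit_self W)]
    exact hk
  refine ⟨χ ^ k, fun s hs => ⟨fun hmem => ?_, fun hmem => ?_⟩⟩
  · obtain ⟨g, hg⟩ := hmem
    have hconj : g⁻¹ * s * g ∈ P := by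
      rw [hP]
      intro x hx
      have hgx : (g : V ≃ₗ[ℂ] V) x ∈ fixedSpace (s : V ≃ₗ[ℂ] V) := by
        rw [← hg]
        exact Submodule.smul_mem_pointwise_smul x (g : V ≃ₗ[ℂ] V) W hx
      rw [mem_fixedSpace] at hgx ⊢
      simp [LinearEquiv.mul_apply, hgx]
    obtain ⟨m, hm⟩ := Subgroup.mem_zpowers_iff.1 (ht ⟨_, hconj⟩)
    have hsm : s = g * (t : G) ^ m * g⁻¹ := by
      rw [← Subgroup.coe_zpow, hm]
      group
    have hψs : (χ ^ k) s = μ ^ m := by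
      rw [hsm, map_mul, map_mul, map_zpow, hψt, map_inv, mul_inv_cancel_comm]
    have hzm : z ^ m ∈ Subgroup.center G := zpow_mem hz m
    have hφs : φ s = (φ g * r ^ m * (φ g)⁻¹) * z ^ m := by
      rw [hsm, map_mul, map_mul, map_inv, map_zpow, hφt, hcomm.mul_zpow]
      have := Subgroup.mem_center_iff.1 hzm (φ g)⁻¹
      simp only [mul_assoc, this]
    refine ⟨φ g * r ^ m * (φ g)⁻¹, z ^ m, ?_, ?_, hφs⟩
    · refine (isPseudoReflection_of_le_fixedSpace
        (W := (φ g : V ≃ₗ[ℂ] V) • fixedSpace (r : V ≃ₗ[ℂ] V)) ?_ ?_ (hfinG _) ?_).1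
      · rw [finrank_smul_submodule]
        exact hr.2.2
      · intro x hx
        rw [mem_smul_submodule, mem_fixedSpace] at hx
        have hx' : (r : V ≃ₗ[ℂ] V) ^ m ∈
            MulAction.stabilizer (V ≃ₗ[ℂ] V) ((φ g : V ≃ₗ[ℂ] V)⁻¹ x) :=
          zpow_mem (MulAction.mem_stabilizer_iff.2 hx) _
        have hx'' := MulAction.mem_stabilizer_iff.1 hx'
        rw [LinearEquiv.smul_def] at hx''
        rw [mem_fixedSpace, Subgroup.coe_mul, Subgroup.coe_mul, Subgroup.coe_inv,
          Subgroup.coe_zpow, LinearEquiv.mul_apply, LinearEquiv.mul_apply, hx'',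
          ← LinearEquiv.mul_apply, mul_inv_cancel, LinearEquiv.coe_one, id_eq]
      · intro h
        rw [show φ g * r ^ m * (φ g)⁻¹ = 1 from Subtype.ext h, one_mul] at hφs
        have hsc : s ∈ Subgroup.center G := by
          rw [Subgroup.mem_center_iff]
          intro h
          apply φ.injective
          rw [map_mul, map_mul, hφs]
          exact Subgroup.mem_center_iff.1 hzm _
        obtain ⟨x, hx0, hx⟩ := hs.exists_fixed hV
        exact hs.2.1 (congrArg Subtype.val (hirr.eq_one_of_fixes hsc hx0 hx))
    · rw [hψs, map_zpow, Subgroup.coe_zpow, hμ]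
  · rw [MonoidHom.zpow_apply, (hχ s _ hs.2.2 le_rfl).2 hmem, one_zpow]

/-- The central parts of the images of the reflections can be chosen so as to be the values of a
single linear character. -/
lemma exists_central_character {G : Subgroup (V ≃ₗ[ℂ] V)} [Finite G]
    (hirr : ActsIrreducibly G) (hV : 2 ≤ finrank ℂ V) (φ : MulAut G)
    (hR : ∀ g : G, IsPseudoReflection (g : V ≃ₗ[ℂ] V) →
      ∃ s z : G, IsPseudoReflection (s : V ≃ₗ[ℂ] V) ∧ z ∈ Subgroup.center G ∧ φ g = s * z) :
    ∃ ψ : G →* ℂˣ, ∀ s : G, IsPseudoReflection (s : V ≃ₗ[ℂ] V) →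
      ∃ r z : G, IsPseudoReflection (r : V ≃ₗ[ℂ] V) ∧
        (z : V ≃ₗ[ℂ] V) = homothety (ψ s) ∧ φ s = r * z := by
  classical
  have hfin : (Set.univ : Set {s : G // IsPseudoReflection (s : V ≃ₗ[ℂ] V)}).Finite :=
    Set.finite_univ
  suffices H : ∀ T : Finset {s : G // IsPseudoReflection (s : V ≃ₗ[ℂ] V)},
      ∃ ψ : G →* ℂˣ, ∀ s : G, IsPseudoReflection (s : V ≃ₗ[ℂ] V) →
      ((∃ t ∈ T, fixedSpace (s : V ≃ₗ[ℂ] V) ∈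
          MulAction.orbit G (fixedSpace (t.1 : V ≃ₗ[ℂ] V))) →
        ∃ r z : G, IsPseudoReflection (r : V ≃ₗ[ℂ] V) ∧
          (z : V ≃ₗ[ℂ] V) = homothety (ψ s) ∧ φ s = r * z) ∧
      ((¬ ∃ t ∈ T, fixedSpace (s : V ≃ₗ[ℂ] V) ∈
          MulAction.orbit G (fixedSpace (t.1 : V ≃ₗ[ℂ] V))) → ψ s = 1) by
    obtain ⟨ψ, hψ⟩ := H hfin.toFinset
    exact ⟨ψ, fun s hs => (hψ s hs).1
      ⟨⟨s, hs⟩, hfin.mem_toFinset.2 (Set.mem_univ _), MulAction.mem_orbit_self _⟩⟩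
  intro T
  induction T using Finset.induction_on with
  | empty => exact ⟨1, fun s hs => ⟨by simp, fun _ => rfl⟩⟩
  | insert u T _ ih =>
    obtain ⟨ψ, hψ⟩ := ih
    by_cases hu : ∃ t ∈ T, fixedSpace (u.1 : V ≃ₗ[ℂ] V) ∈
        MulAction.orbit G (fixedSpace (t.1 : V ≃ₗ[ℂ] V))
    · obtain ⟨t, htT, hut⟩ := hu
      refine ⟨ψ, fun s hs => ⟨fun h => (hψ s hs).1 ?_, fun h => (hψ s hs).2 fun h' => h ?_⟩⟩
      · obtain ⟨v, hv, hsv⟩ := h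
        rcases Finset.mem_insert.1 hv with rfl | hv
        · exact ⟨t, htT, MulAction.orbit_eq_iff.2 hut ▸ hsv⟩
        · exact ⟨v, hv, hsv⟩
      · obtain ⟨v, hv, hsv⟩ := h'
        exact ⟨v, Finset.mem_insert_of_mem hv, hsv⟩
    · obtain ⟨ψ', hψ'⟩ := exists_orbit_central_character hirr hV φ hR u.2
      refine ⟨ψ * ψ', fun s hs => ⟨fun h => ?_, fun h => ?_⟩⟩
      · rw [MonoidHom.mul_apply]
        by_cases hsu : fixedSpace (s : V ≃ₗ[ℂ] V) ∈
            MulAction.orbit G (fixedSpace (u.1 : V ≃ₗ[ℂ] V))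
        · rw [(hψ s hs).2, one_mul]
          · exact (hψ' s hs).1 hsu
          · rintro ⟨t, ht, hst⟩
            refine hu ⟨t, ht, ?_⟩
            rw [← MulAction.orbit_eq_iff] at hst hsu ⊢
            rw [← hsu, hst]
        · rw [(hψ' s hs).2 hsu, mul_one]
          refine (hψ s hs).1 ?_
          obtain ⟨v, hv, hsv⟩ := h
          rcases Finset.mem_insert.1 hv with rfl | hv
          · exact absurd hsv hsu
          · exact ⟨v, hv, hsv⟩
      · rw [MonoidHom.mul_apply, (hψ s hs).2, (hψ' s hs).2, one_mul]
        · exact fun h' => h ⟨u, Finset.mem_insert_self _ _, h'⟩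
        · rintro ⟨v, hv, hsv⟩
          exact h ⟨v, Finset.mem_insert_of_mem hv, hsv⟩

/-- Every finite linear group preserves a positive definite hermitian form. -/
lemma exists_invariant_hermitian_form (G : Subgroup (V ≃ₗ[ℂ] V)) [Finite G] :
    ∃ B : V → V → ℂ, (∀ v : V, IsLinearMap ℂ (B v)) ∧
      (∀ (w : V) (a : ℂ) (v v' : V),
        B (a • v + v') w = starRingEnd ℂ a * B v w + B v' w) ∧
      (∀ v w : V, B w v = starRingEnd ℂ (B v w)) ∧
      (∀ g ∈ G, ∀ v w : V, B ((g : V ≃ₗ[ℂ] V) v) ((g : V ≃ₗ[ℂ] V) w) = B v w) ∧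
      (∀ v : V, v ≠ 0 → 0 < (B v v).re) := by
  have := Fintype.ofFinite G
  let b := Module.finBasis ℂ V
  refine ⟨fun v w => ∑ g : G, ∑ i, starRingEnd ℂ (b.repr ((g : V ≃ₗ[ℂ] V) v) i) *
    b.repr ((g : V ≃ₗ[ℂ] V) w) i, ?_, ?_, ?_, ?_, ?_⟩
  · intro v
    constructor
    · intro x y
      simp [mul_add, Finset.sum_add_distrib]
    · intro c x
      simp [Finset.mul_sum, mul_left_comm]
  · intro w a v v'
    simp [add_mul, Finset.sum_add_distrib, Finset.mul_sum, mul_assoc]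
  · intro v w
    simp [mul_comm]
  · intro h hh v w
    exact Equiv.sum_comp (Equiv.mulRight (⟨h, hh⟩ : G)) fun g : G =>
      ∑ i, starRingEnd ℂ (b.repr ((g : V ≃ₗ[ℂ] V) v) i) * b.repr ((g : V ≃ₗ[ℂ] V) w) i
  · intro v hv
    have hnn : ∀ g : G, ∀ i, 0 ≤ (starRingEnd ℂ (b.repr ((g : V ≃ₗ[ℂ] V) v) i) *
        b.repr ((g : V ≃ₗ[ℂ] V) v) i).re := fun g i => by
      rw [← Complex.normSq_eq_conj_mul_self, Complex.ofReal_re]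
      exact Complex.normSq_nonneg _
    simp only [Complex.re_sum]
    obtain ⟨i, hi⟩ : ∃ i, b.repr v i ≠ 0 := by
      by_contra! h
      exact hv (b.repr.map_eq_zero_iff.1 (Finsupp.ext h))
    refine Finset.sum_pos' (fun g _ => Finset.sum_nonneg fun i _ => hnn g i)
      ⟨1, Finset.mem_univ _, Finset.sum_pos' (fun i _ => hnn 1 i) ⟨i, Finset.mem_univ _, ?_⟩⟩
    rw [← Complex.normSq_eq_conj_mul_self, Complex.ofReal_re]
    exact Complex.normSq_pos.2 hi

lemma inf_fixedSpace_ne_bot {g h : V ≃ₗ[ℂ] V} (hg : IsPseudoReflection g)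
    (hh : IsPseudoReflection h) (hV : 3 ≤ finrank ℂ V) : fixedSpace g ⊓ fixedSpace h ≠ ⊥ := by
  intro hbot
  have h1 := Submodule.finrank_sup_add_finrank_inf_eq (fixedSpace g) (fixedSpace h)
  rw [hbot, finrank_bot] at h1
  have h2 := Submodule.finrank_le (fixedSpace g ⊔ fixedSpace h)
  have h3 : finrank ℂ (fixedSpace g) + 1 = finrank ℂ V := hg.2.2
  have h4 : finrank ℂ (fixedSpace h) + 1 = finrank ℂ V := hh.2.2
  omega

lemma det_eq_of_apply_eq_smul {W : Submodule ℂ V} (hW : finrank ℂ W + 1 = finrank ℂ V)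
    {g : V ≃ₗ[ℂ] V} (hg : W ≤ fixedSpace g) {y : V} (hy : y ∉ W) {c : ℂˣ}
    (hc : g y = (c : ℂ) • y) : LinearEquiv.det g = c := by
  obtain ⟨a, rfl, e, he⟩ := exists_dual_ker_eq hW
  have h := dual_apply_eq_det_mul he hg y
  rw [hc, map_smul, smul_eq_mul] at h
  exact Units.ext (mul_right_cancel₀ (by simpa using hy) h).symm

/-- If the reflections `s = c • t` have complementary hyperplanes which are exchanged by `g`, then
`g` conjugates `s` to the inverse of `t`. -/
lemma conj_eq_inv_of_eq_homothety_mul {G : Subgroup (V ≃ₗ[ℂ] V)} [Finite G]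
    (hV : 2 ≤ finrank ℂ V) {s t g : G} (hs : IsPseudoReflection (s : V ≃ₗ[ℂ] V))
    (ht : IsPseudoReflection (t : V ≃ₗ[ℂ] V)) {c : ℂˣ}
    (hsct : (s : V ≃ₗ[ℂ] V) = homothety c * (t : V ≃ₗ[ℂ] V))
    (hbot : fixedSpace (s : V ≃ₗ[ℂ] V) ⊓ fixedSpace (t : V ≃ₗ[ℂ] V) = ⊥)
    (hgst : fixedSpace (t : V ≃ₗ[ℂ] V) =
      (fixedSpace (s : V ≃ₗ[ℂ] V)).map ((g : V ≃ₗ[ℂ] V) : V →ₗ[ℂ] V)) :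
    g * s * g⁻¹ = t⁻¹ := by
  have hs1 : finrank ℂ (fixedSpace (s : V ≃ₗ[ℂ] V)) + 1 = finrank ℂ V := hs.2.2
  have ht1 : finrank ℂ (fixedSpace (t : V ≃ₗ[ℂ] V)) + 1 = finrank ℂ V := ht.2.2
  obtain ⟨x, hx0, hx⟩ := hs.exists_fixed hV
  obtain ⟨y, hy0, hy⟩ := ht.exists_fixed hV
  have hdets : LinearEquiv.det (s : V ≃ₗ[ℂ] V) = c := by
    refine det_eq_of_apply_eq_smul hs1 le_rfl (y := y) (fun h => hy0 ?_) ?_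
    · exact (Submodule.mem_bot ℂ).1 (hbot ▸ ⟨h, mem_fixedSpace.2 hy⟩)
    · rw [hsct, LinearEquiv.mul_apply, hy, homothety_apply]
  have hdett : LinearEquiv.det (t : V ≃ₗ[ℂ] V) = c⁻¹ := by
    refine det_eq_of_apply_eq_smul ht1 le_rfl (y := x) (fun h => hx0 ?_) ?_
    · exact (Submodule.mem_bot ℂ).1 (hbot ▸ ⟨mem_fixedSpace.2 hx, h⟩)
    · rw [hsct, LinearEquiv.mul_apply, homothety_apply] at hx
      rw [Units.val_inv_eq_inv_val, eq_inv_smul_iff₀ c.ne_zero, hx]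
  rw [eq_inv_iff_mul_eq_one]
  refine Subtype.ext (eq_one_of_det_eq_one ht1 (fun z hz => ?_)
    (G.subtype.isOfFinOrder (isOfFinOrder_of_finite (g * s * g⁻¹ * t))) ?_)
  · have h1 := mem_fixedSpace.1 hz
    rw [hgst] at hz
    obtain ⟨v, hv, rfl⟩ := hz
    have h2 := mem_fixedSpace.1 hv
    rw [LinearEquiv.coe_coe] at h1 ⊢
    have h3 : ((g⁻¹ : G) : V ≃ₗ[ℂ] V) ((g : V ≃ₗ[ℂ] V) v) = v := by
      rw [Subgroup.coe_inv, ← LinearEquiv.mul_apply, inv_mul_cancel, LinearEquiv.coe_one, id_eq]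
    rw [mem_fixedSpace, Subgroup.coe_mul, Subgroup.coe_mul, Subgroup.coe_mul,
      LinearEquiv.mul_apply, LinearEquiv.mul_apply, LinearEquiv.mul_apply, h1, h3, h2]
  · rw [Subgroup.coe_mul, Subgroup.coe_mul, Subgroup.coe_mul, Subgroup.coe_inv, map_mul, map_mul,
      map_mul, map_inv, mul_inv_cancel_comm, hdets, hdett, mul_inv_cancel]

/-- Let `φ = β · ζ` be injective, with `ζ` central. If `β` takes the same value, a reflection, at
`s` and at a conjugate of the inverse of the reflection `s`, then these elements are equal. -/
lemma eq_of_conj_eq_inv {G : Subgroup (V ≃ₗ[ℂ] V)} [Finite G] (hirr : ActsIrreducibly G)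
    (hV : 2 ≤ finrank ℂ V) {φ : MulAut G} {β ζ : G →* G} (hφβ : ∀ g, φ g = β g * ζ g)
    (hζ : ∀ g, ζ g ∈ Subgroup.center G) (hker : ∀ g, β g = 1 → g ∈ Subgroup.center G)
    {s t g : G} (hs : IsPseudoReflection (s : V ≃ₗ[ℂ] V))
    (hβs : IsPseudoReflection (β s : V ≃ₗ[ℂ] V)) (hst : β s = β t)
    (hconj : g * s * g⁻¹ = t⁻¹) : s = t := by
  have hsq : β s * β s = 1 := by
    have hr1 : finrank ℂ (fixedSpace (β s : V ≃ₗ[ℂ] V)) + 1 = finrank ℂ V := hβs.2.2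
    refine Subtype.ext (eq_one_of_det_eq_one hr1 (fun v hv => ?_)
      (G.subtype.isOfFinOrder (isOfFinOrder_of_finite (β s * β s))) ?_)
    · rw [mem_fixedSpace] at hv ⊢
      rw [Subgroup.coe_mul, LinearEquiv.mul_apply, hv, hv]
    · have h := congrArg (LinearEquiv.det.comp (G.subtype.comp β)) hconj
      rw [map_mul, map_mul, map_inv, map_inv, mul_inv_cancel_comm,
        show (LinearEquiv.det.comp (G.subtype.comp β)) t =
          (LinearEquiv.det.comp (G.subtype.comp β)) s from
          congrArg (LinearEquiv.det.comp G.subtype) hst.symm] at h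
      rw [Subgroup.coe_mul, map_mul]
      exact mul_eq_one_iff_eq_inv.2 h
  obtain ⟨x, hx0, hx⟩ := hs.exists_fixed hV
  have hs2 : s * s = 1 := hirr.eq_one_of_fixes (hker _ (by rw [map_mul, hsq])) hx0
    (by rw [Subgroup.coe_mul, LinearEquiv.mul_apply, hx, hx])
  have hconj' : g * s * g⁻¹ = t := by
    rw [← inv_inj, ← hconj, mul_inv_rev, mul_inv_rev, inv_inv, inv_eq_of_mul_eq_one_left hs2,
      mul_assoc]
  have hζst : ζ s = ζ t := by
    rw [← hconj', map_mul, map_mul, map_inv, Subgroup.mem_center_iff.1 (hζ s),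
      mul_inv_cancel_right]
  apply φ.injective
  rw [hφβ, hφβ, hst, hζst]

end ReflectionGroups

/-- **Proposition 15 (Marin–Michel).** Let `G ⊂ GL(V)` be an irreducible complex reflection
group with set of reflections `R`, and let `φ` be an automorphism of `G` mapping `R` into
`R·Z(G)`.  If either `dim V ≥ 3`, or any two orthogonal reflecting hyperplanes of `G`
(w.r.t. any `G`-invariant hermitian scalar product) are conjugate under `G`, then
`φ ∈ C·A`. -/
theorem refl_to_refl_times_center_implies_CA
    {V : Type} [AddCommGroup V] [Module ℂ V] [FiniteDimensional ℂ V]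
    (G : Subgroup (V ≃ₗ[ℂ] V)) (hG : IsReflectionGroup G) (hirr : ActsIrreducibly G)
    (φ : MulAut ↥G)
    -- `φ` maps reflections into `R · Z(G)`:
    (hR : ∀ g : ↥G, IsPseudoReflection ((g : V ≃ₗ[ℂ] V)) →
      ∃ s z : ↥G, IsPseudoReflection ((s : V ≃ₗ[ℂ] V)) ∧ z ∈ Subgroup.center ↥G ∧
        φ g = s * z)
    -- either `dim V ≥ 3`, or orthogonal reflecting hyperplanes are conjugate:
    (hcase : 3 ≤ Module.finrank ℂ V ∨
      (∀ B : V → V → ℂ,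
        (∀ v : V, IsLinearMap ℂ (B v)) →
        (∀ (w : V) (a : ℂ) (v v' : V),
          B (a • v + v') w = starRingEnd ℂ a * B v w + B v' w) →
        (∀ v w : V, B w v = starRingEnd ℂ (B v w)) →
        (∀ g ∈ G, ∀ v w : V, B ((g : V ≃ₗ[ℂ] V) v) ((g : V ≃ₗ[ℂ] V) w) = B v w) →
        (∀ v : V, v ≠ 0 → 0 < (B v v).re) →
        ∀ H₁ H₂ : Submodule ℂ V,
          (∃ g ∈ G, IsPseudoReflection g ∧
            LinearMap.ker (((g : V ≃ₗ[ℂ] V) : V →ₗ[ℂ] V) - LinearMap.id) = H₁) →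
          (∃ g ∈ G, IsPseudoReflection g ∧
            LinearMap.ker (((g : V ≃ₗ[ℂ] V) : V →ₗ[ℂ] V) - LinearMap.id) = H₂) →
          -- `H₁` and `H₂` are orthogonal w.r.t. `B`:
          (∀ v w : V, (∀ x ∈ H₁, B v x = 0) → (∀ x ∈ H₂, B w x = 0) → B v w = 0) →
          ∃ g ∈ G, H₂ = H₁.map ((g : V ≃ₗ[ℂ] V) : V →ₗ[ℂ] V))) :
    ∃ α β : MulAut ↥G, IsCentralAut α ∧ PreservesReflections G β ∧ φ = α * β := by
  have := hG.1
  have := hirr.1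
  by_cases hV : finrank ℂ V ≤ 1
  · -- in dimension one every automorphism is central
    refine ⟨φ, 1, fun g => ?_, fun g => Iff.rfl, (mul_one φ).symm⟩
    rw [Subgroup.mem_center_iff]
    intro h
    obtain ⟨v, hv⟩ := finrank_le_one_iff.1 hV
    have key : ∀ (a b : V ≃ₗ[ℂ] V), a * b = b * a := by
      intro a b
      ext x
      obtain ⟨c, rfl⟩ := hv x
      obtain ⟨p, hp⟩ := hv (a v)
      obtain ⟨q, hq⟩ := hv (b v)
      rw [LinearEquiv.mul_apply, LinearEquiv.mul_apply, map_smul, map_smul, map_smul, map_smul,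
        ← hp, ← hq, map_smul, map_smul, ← hp, ← hq, smul_comm p q]
    exact Subtype.ext (key _ _)
  replace hV : 2 ≤ finrank ℂ V := by omega
  obtain ⟨ψ, hψ⟩ := exists_central_character hirr hV φ hR
  have hmem : ∀ g, homothety (ψ g) ∈ G := by
    have htop : G.comap (homothety.comp ψ) = ⊤ := eq_top_of_reflections_mem hG fun s hs => by
      obtain ⟨r, z, -, hz, -⟩ := hψ s hs
      change homothety (ψ s) ∈ G
      exact hz ▸ z.2
    exact fun g => (htop ▸ Subgroup.mem_top g : g ∈ G.comap (homothety.comp ψ))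
  let ζ : G →* G := (homothety.comp ψ).codRestrict G hmem
  have hζ : ∀ g, ζ g ∈ Subgroup.center G := fun g => mem_center_of_eq_homothety (c := ψ g) rfl
  let β : G →* G :=
    { toFun := fun g => φ g * (ζ g)⁻¹
      map_one' := by simp
      map_mul' := fun g h => by
        have := Subgroup.mem_center_iff.1 (inv_mem (hζ g)) (φ h)
        have hc := Subgroup.mem_center_iff.1 (inv_mem (hζ g)) (ζ h)⁻¹
        simp only [map_mul, mul_inv_rev, mul_assoc]
        rw [hc, ← mul_assoc (φ h), this, mul_assoc] }
  have hφβ : ∀ g, φ g = β g * ζ g := fun g => (inv_mul_cancel_right _ _).symm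
  have hβR : ∀ s : G, IsPseudoReflection (s : V ≃ₗ[ℂ] V) →
      IsPseudoReflection (β s : V ≃ₗ[ℂ] V) := by
    intro s hs
    obtain ⟨r, z, hr, hz, hφs⟩ := hψ s hs
    have : β s = r := by
      rw [show z = ζ s from Subtype.ext hz, hφβ s] at hφs
      exact mul_right_cancel hφs
    rwa [this]
  have hker : ∀ g, β g = 1 → g ∈ Subgroup.center G := by
    intro g hg
    rw [Subgroup.mem_center_iff]
    intro h
    apply φ.injective
    rw [map_mul, map_mul, hφβ g, hg, one_mul]
    exact Subgroup.mem_center_iff.1 (hζ g) _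
  have hinjR : ∀ s t : G, IsPseudoReflection (s : V ≃ₗ[ℂ] V) →
      IsPseudoReflection (t : V ≃ₗ[ℂ] V) → β s = β t → s = t := by
    intro s t hs ht hst
    by_contra hne
    have hz : s * t⁻¹ ∈ Subgroup.center G := hker _ (by rw [map_mul, map_inv, hst, mul_inv_cancel])
    have hbot : fixedSpace (s : V ≃ₗ[ℂ] V) ⊓ fixedSpace (t : V ≃ₗ[ℂ] V) = ⊥ := by
      by_contra hbot
      obtain ⟨x, ⟨hxs, hxt⟩, hx0⟩ := Submodule.exists_mem_ne_zero_of_ne_bot hbot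
      refine hne (mul_inv_eq_one.1 (hirr.eq_one_of_fixes hz hx0 ?_))
      have htx : ((t⁻¹ : G) : V ≃ₗ[ℂ] V) x = x := by
        conv_lhs => rw [← mem_fixedSpace.1 hxt]
        rw [← LinearEquiv.mul_apply, ← Subgroup.coe_mul, inv_mul_cancel, Subgroup.coe_one,
          LinearEquiv.coe_one, id_eq]
      rw [Subgroup.coe_mul, LinearEquiv.mul_apply, htx, mem_fixedSpace.1 hxs]
    obtain ⟨c, hc⟩ := hirr.exists_eq_homothety hz
    have hc1 : c ≠ 1 := by
      rintro rfl
      exact hne (mul_inv_eq_one.1 (Subtype.ext (by rw [hc, map_one, Subgroup.coe_one])))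
    have hsct : (s : V ≃ₗ[ℂ] V) = homothety c * (t : V ≃ₗ[ℂ] V) := by
      rw [← hc, ← Subgroup.coe_mul, inv_mul_cancel_right]
    have hdim : ¬ 3 ≤ finrank ℂ V := fun h => inf_fixedSpace_ne_bot hs ht h hbot
    have hs1 : finrank ℂ (fixedSpace (s : V ≃ₗ[ℂ] V)) + 1 = finrank ℂ V := hs.2.2
    have ht1 : finrank ℂ (fixedSpace (t : V ≃ₗ[ℂ] V)) + 1 = finrank ℂ V := ht.2.2
    have hsup : fixedSpace (s : V ≃ₗ[ℂ] V) ⊔ fixedSpace (t : V ≃ₗ[ℂ] V) = ⊤ := by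
      apply Submodule.eq_top_of_finrank_eq
      have h := Submodule.finrank_sup_add_finrank_inf_eq (fixedSpace (s : V ≃ₗ[ℂ] V))
        (fixedSpace (t : V ≃ₗ[ℂ] V))
      rw [hbot, finrank_bot] at h
      omega
    obtain ⟨B, hB1, hB2, hB3, hB4, hB5⟩ := exists_invariant_hermitian_form G
    obtain ⟨g, hg, hgst⟩ := hcase.resolve_left hdim B hB1 hB2 hB3 hB4 hB5
      (fixedSpace (s : V ≃ₗ[ℂ] V)) (fixedSpace (t : V ≃ₗ[ℂ] V))
      ⟨s, s.2, hs, rfl⟩ ⟨t, t.2, ht, rfl⟩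
      (fun v w => orthogonal_of_eq_homothety_mul hc1 hsct hsup hB1 hB2 (hB4 s s.2) hB5)
    exact hne (eq_of_conj_eq_inv hirr hV hφβ hζ hker hs (hβR s hs) hst
      (conj_eq_inv_of_eq_homothety_mul (g := (⟨g, hg⟩ : G)) hV hs ht hsct hbot hgst))
  have hsurjR : ∀ t : G, IsPseudoReflection (t : V ≃ₗ[ℂ] V) →
      ∃ s : G, IsPseudoReflection (s : V ≃ₗ[ℂ] V) ∧ β s = t := by
    let f : {s : G // IsPseudoReflection (s : V ≃ₗ[ℂ] V)} →
        {s : G // IsPseudoReflection (s : V ≃ₗ[ℂ] V)} := fun s => ⟨β s, hβR s s.2⟩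
    have hf : Function.Injective f := fun s t h =>
      Subtype.ext (hinjR s t s.2 t.2 (congrArg Subtype.val h))
    intro t ht
    obtain ⟨s, hs⟩ := Finite.surjective_of_injective hf ⟨t, ht⟩
    exact ⟨s, s.2, congrArg Subtype.val hs⟩
  have hsurj : Function.Surjective β := by
    rw [← MonoidHom.range_eq_top]
    refine eq_top_of_reflections_mem hG fun t ht => ?_
    obtain ⟨s, -, hs⟩ := hsurjR t ht
    exact ⟨s, hs⟩
  have hinj : Function.Injective β := Finite.injective_iff_surjective.2 hsurj
  let β' : MulAut G := MulEquiv.ofBijective β ⟨hinj, hsurj⟩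
  refine ⟨φ * β'⁻¹, β', fun g => ?_, fun g => ⟨hβR g, fun hg => ?_⟩,
    (inv_mul_cancel_right φ β').symm⟩
  · obtain ⟨h, rfl⟩ := hsurj g
    have : (φ * β'⁻¹) (β h) = φ h := congrArg φ (β'.symm_apply_apply h)
    rw [this, hφβ, inv_mul_cancel_left]
    exact hζ h
  · obtain ⟨s, hs, hsg⟩ := hsurjR _ hg
    rwa [← hinj hsg]
end

section
/- Let G = G_1 × … × G_n be a direct product of finite quasi-indecomposable groups such that for all i, j, can(G_i) ≅ can(G_j) implies G_i ≅ G_j. Then every automorphism of G is of the form α ∘ β, where α is a central automorphism of G and β satisfies β(G_i) = G_{σ(i)} for some permutation σ of {1, …, n}. -/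
/-- Two subgroups give an (internal) direct product decomposition of `H`. -/
def IsInternalDirectProd {H : Type*} [Group H] (A B : Subgroup H) : Prop :=
  (∀ a ∈ A, ∀ b ∈ B, a * b = b * a) ∧ A ⊓ B = ⊥ ∧ A ⊔ B = ⊤

/-- A group is indecomposable if it admits no non-trivial direct product decomposition. -/
def IndecomposableGroup (H : Type*) [Group H] : Prop :=
  ∀ A B : Subgroup H, IsInternalDirectProd A B → A = ⊥ ∨ B = ⊥

/-- A group is quasi-indecomposable if in any direct product decomposition one of the two
factors is central. -/
def QuasiIndecomposable (H : Type*) [Group H] : Prop :=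
  ∀ A B : Subgroup H, IsInternalDirectProd A B →
    A ≤ Subgroup.center H ∨ B ≤ Subgroup.center H

/-- A decomposition `H = Z × Ĥ` with `Z` central and `Ĥ = can(H)` trivial or
indecomposable non-abelian. -/
def IsCanonicalDecomp {H : Type*} [Group H] (Z Hhat : Subgroup H) : Prop :=
  IsInternalDirectProd Z Hhat ∧ Z ≤ Subgroup.center H ∧
    (Hhat = ⊥ ∨ ((¬ ∀ a ∈ Hhat, ∀ b ∈ Hhat, a * b = b * a) ∧ IndecomposableGroup ↥Hhat))

/-- The `i`-th factor `Gᵢ` of the direct product `G₁ × … × Gₙ`, as a subgroup of the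
product. -/
def piFactor {n : ℕ} (H : Fin n → Type*) [∀ i, Group (H i)] (i : Fin n) :
    Subgroup (∀ j, H j) where
  carrier := {f | ∀ j, j ≠ i → f j = 1}
  one_mem' := fun _ _ => rfl
  mul_mem' := by
    intro a b ha hb j hj
    simp [ha j hj, hb j hj]
  inv_mem' := by
    intro a ha j hj
    simp [ha j hj]

section

open scoped commutatorElement

theorem exists_pos_isIdempotentElem_pow {M : Type*} [Monoid M] [Finite M] (x : M) :
    ∃ n, 0 < n ∧ IsIdempotentElem (x ^ n) := by
  obtain ⟨a, d, hd, h⟩ : ∃ a d, 0 < d ∧ x ^ (a + d) = x ^ a := by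
    obtain ⟨a, b, hab, h⟩ := Finite.exists_ne_map_eq_of_infinite (fun n : ℕ => x ^ n)
    rcases hab.lt_or_gt with hlt | hlt
    · exact ⟨a, b - a, by omega, by rw [Nat.add_sub_cancel' hlt.le]; exact h.symm⟩
    · exact ⟨b, a - b, by omega, by rw [Nat.add_sub_cancel' hlt.le]; exact h⟩
  have periodic : ∀ k, x ^ (a + k * d) = x ^ a := by
    intro k
    induction k with
    | zero => simp
    | succ k ih =>
      rw [show a + (k + 1) * d = (a + k * d) + d by ring, pow_add, ih, ← pow_add, h]
  have hle : a ≤ (a + 1) * d := by nlinarith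
  obtain ⟨m, hm⟩ := Nat.exists_eq_add_of_le hle
  refine ⟨(a + 1) * d, by positivity, ?_⟩
  rw [IsIdempotentElem, ← pow_add]
  conv_lhs => rw [show (a + 1) * d + (a + 1) * d = (a + (a + 1) * d) + m by omega]
  rw [pow_add, periodic, ← pow_add, ← hm]

/-- A normal endomorphism: one that commutes with all inner automorphisms. -/
def IsNormalEnd {K : Type*} [Group K] (f : K →* K) : Prop :=
  ∀ g x, f (g * x * g⁻¹) = g * f x * g⁻¹

namespace IsNormalEnd

variable {K L : Type*} [Group K] [Group L] {f : K →* K}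

theorem map_commutator_left (hf : IsNormalEnd f) (x y : K) : f ⁅x, y⁆ = ⁅f x, y⁆ := by
  have h := hf y x⁻¹
  rw [commutatorElement_def, commutatorElement_def,
    show x * y * x⁻¹ * y⁻¹ = x * (y * x⁻¹ * y⁻¹) by group, map_mul, h, map_inv]
  group

theorem map_commutator_right (hf : IsNormalEnd f) (x y : K) : f ⁅x, y⁆ = ⁅x, f y⁆ := by
  rw [commutatorElement_def, commutatorElement_def, map_mul, hf, map_inv]

theorem map_map_commutator (hf : IsNormalEnd f) (x y : K) : f (f ⁅x, y⁆) = f ⁅x, y⁆ := by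
  rw [hf.map_commutator_left, hf.map_commutator_right, ← map_commutatorElement,
    hf.map_commutator_left]

theorem map_mem_center_of_map_commutator (hf : IsNormalEnd f) {x : K}
    (h : ∀ y, f ⁅x, y⁆ = 1) : f x ∈ Subgroup.center K := by
  rw [Subgroup.mem_center_iff]
  intro y
  have := h y
  rw [hf.map_commutator_left, commutatorElement_eq_one_iff_mul_comm] at this
  exact this.symm

/-- Some positive iterate of an endomorphism of a finite group is idempotent. -/
theorem exists_idempotent_iterate [Finite K] (hf : IsNormalEnd f) :
    ∃ (m : ℕ) (g : K →* K), IsNormalEnd g ∧ (∀ x, g x = f^[m] (f x)) ∧ ∀ x, g (g x) = g x := by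
  have : Finite (Monoid.End K) := DFunLike.finite (K →* K)
  obtain ⟨n, hn, hi⟩ := exists_pos_isIdempotentElem_pow (M := Monoid.End K) f
  obtain ⟨m, rfl⟩ := Nat.exists_eq_succ_of_ne_zero hn.ne'
  obtain ⟨g, hg⟩ : ∃ g : Monoid.End K, g = (show Monoid.End K from f) ^ (m + 1) := ⟨_, rfl⟩
  have hgx : ∀ x, g x = f^[m] (f x) := fun x => by
    rw [hg]
    exact congrFun (Monoid.End.coe_pow K f (m + 1)) x
  refine ⟨m, g, fun c x => ?_, hgx, fun x => ?_⟩
  · have key : ∀ k y, f^[k] (c * y * c⁻¹) = c * f^[k] y * c⁻¹ := by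
      intro k
      induction k with
      | zero => intro y; rfl
      | succ k ih => intro y; rw [Function.iterate_succ_apply, hf, ih, Function.iterate_succ_apply]
    have h1 := hgx (c * x * c⁻¹)
    rw [hf, key, ← hgx] at h1
    exact h1
  · rw [hg]
    exact DFunLike.congr_fun hi x

theorem isInternalDirectProd_ker_range (hf : IsNormalEnd f) (hi : ∀ x, f (f x) = f x) :
    IsInternalDirectProd f.ker f.range := by
  refine ⟨?_, ?_, ?_⟩
  · rintro a ha _ ⟨c, rfl⟩
    rw [MonoidHom.mem_ker] at ha
    have h := hf a c
    rw [map_mul, map_mul, map_inv, ha] at h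
    rw [eq_mul_inv_iff_mul_eq] at h
    simpa using h.symm
  · rw [eq_bot_iff]
    rintro _ ⟨ha, c, rfl⟩
    have ha : f (f c) = 1 := ha
    rw [hi] at ha
    exact ha
  · rw [eq_top_iff]
    intro x _
    have h1 : x * (f x)⁻¹ ∈ f.ker := by rw [MonoidHom.mem_ker]; simp [hi]
    have := mul_mem (Subgroup.mem_sup_left (T := f.range) h1)
      (Subgroup.mem_sup_right (S := f.ker) ⟨x, rfl⟩)
    simpa using this

/-- Fitting's dichotomy: a normal endomorphism of a finite indecomposable group is either
bijective or takes its values in the centre. -/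
theorem bijective_or_mem_center [Finite K] (hK : IndecomposableGroup K) (hf : IsNormalEnd f) :
    Function.Bijective f ∨ ∀ x, f x ∈ Subgroup.center K := by
  obtain ⟨m, g, hg, hgx, hi⟩ := hf.exists_idempotent_iterate
  have fix_one : ∀ k, f^[k] 1 = 1 := fun k => Function.iterate_fixed (map_one f) k
  rcases hK _ _ (hg.isInternalDirectProd_ker_range hi) with h | h
  · left
    rw [← Finite.injective_iff_bijective, injective_iff_map_eq_one]
    intro x hx
    rw [MonoidHom.ker_eq_bot_iff, injective_iff_map_eq_one] at h
    exact h x (by rw [hgx, hx, fix_one])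
  · right
    intro x
    refine hf.map_mem_center_of_map_commutator fun y => ?_
    have h1 := hgx ⁅x, y⁆
    rw [Function.iterate_fixed (hf.map_map_commutator x y) m] at h1
    rw [← h1, ← Subgroup.mem_bot, ← h]
    exact ⟨_, rfl⟩

theorem comp_of_leftInverse (hf : IsNormalEnd f) {s : L →* K} {p : K →* L}
    (h : ∀ x, p (s x) = x) : IsNormalEnd (p.comp (f.comp s)) := by
  intro g x
  simp [hf _ _, h]

end IsNormalEnd

/-- If `b ∘ a` and `a ∘ b` are normal endomorphisms of finite indecomposable groups and `b ∘ a`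
is not central-valued, then `a` is bijective. -/
theorem bijective_of_normal_comp {K L : Type*} [Group K] [Group L] [Finite K] [Finite L]
    (hK : IndecomposableGroup K) (hL : IndecomposableGroup L) {a : K →* L} {b : L →* K}
    (hba : IsNormalEnd (b.comp a)) (hab : IsNormalEnd (a.comp b))
    (hc : ∃ x, b (a x) ∉ Subgroup.center K) : Function.Bijective a := by
  obtain ⟨x, hx⟩ := hc
  have hinj : Function.Bijective (b.comp a) :=
    (hba.bijective_or_mem_center hK).resolve_right fun h => hx (h x)
  have hsurj : Function.Bijective (a.comp b) := by
    refine (hab.bijective_or_mem_center hL).resolve_right fun h => hx ?_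
    refine hba.map_mem_center_of_map_commutator fun y => ?_
    have h1 : (a.comp b) ⁅a x, a y⁆ = 1 := by
      rw [hab.map_commutator_left, commutatorElement_eq_one_iff_mul_comm]
      exact (Subgroup.mem_center_iff.1 (h (a x)) (a y)).symm
    have h2 : (b.comp a) ((b.comp a) ⁅x, y⁆) = 1 := by
      rw [← map_commutatorElement] at h1
      change b ((a.comp b) (a ⁅x, y⁆)) = 1
      rw [h1, map_one]
    rwa [hba.map_map_commutator] at h2
  constructor
  · exact Function.Injective.of_comp (f := b) hinj.1
  · exact Function.Surjective.of_comp (g := b) hsurj.2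

theorem map_mem_center_of_surjective {K L : Type*} [Group K] [Group L] {f : K →* L}
    (hf : Function.Surjective f) {z : K} (hz : z ∈ Subgroup.center K) :
    f z ∈ Subgroup.center L := by
  rw [Subgroup.mem_center_iff] at hz ⊢
  intro g
  obtain ⟨y, rfl⟩ := hf g
  rw [← map_mul, hz, map_mul]

/-- A retraction `p` of a group `K` onto (a copy of) `L`, embedded by `s`, with central kernel. -/
structure IsCentralRetract {K L : Type*} [Group K] [Group L] (s : L →* K) (p : K →* L) : Prop where
  leftInverse : ∀ x, p (s x) = x
  mul_inv_mem_center : ∀ x, x * (s (p x))⁻¹ ∈ Subgroup.center K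

namespace IsCentralRetract

variable {K L K' L' : Type*} [Group K] [Group L] [Group K'] [Group L']
  {s : L →* K} {p : K →* L} {s' : L' →* K'} {p' : K' →* L'}

theorem isNormalEnd (h : IsCentralRetract s p) : IsNormalEnd (s.comp p) := by
  intro g x
  have hc := Subgroup.mem_center_iff.1 (h.mul_inv_mem_center g)
  obtain ⟨z, hz⟩ : ∃ z, z = g * (s (p g))⁻¹ := ⟨_, rfl⟩
  rw [← hz] at hc
  have hg : g = z * s (p g) := by rw [hz]; group
  simp only [MonoidHom.comp_apply, map_mul, map_inv]
  conv_rhs => rw [hg, mul_inv_rev, ← hc (s (p g))]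
  have h1 := hc (s (p x) * (s (p g))⁻¹)
  calc _ = s (p g) * (s (p x) * (s (p g))⁻¹) := by group
    _ = s (p g) * (s (p x) * (s (p g))⁻¹ * z * z⁻¹) := by group
    _ = _ := by rw [h1]; group

theorem map_map_mem_center (h : IsCentralRetract s p) {y : K} {f : K →* L'}
    (hf : ∀ z ∈ Subgroup.center K, f z ∈ Subgroup.center L')
    (hy : f (s (p y)) ∈ Subgroup.center L') :
    f y ∈ Subgroup.center L' := by
  have h1 : f (y * (s (p y))⁻¹) ∈ Subgroup.center L' :=
    hf _ (h.mul_inv_mem_center y)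
  have := mul_mem h1 hy
  simpa using this

/-- An element of `K` is central as soon as its image in `L` is. -/
theorem mem_center_of_map (h : IsCentralRetract s p) {y : K} (hy : p y ∈ Subgroup.center L) :
    y ∈ Subgroup.center K := by
  rw [Subgroup.mem_center_iff] at hy ⊢
  intro g
  have hn : s (p y) ∈ Subgroup.center K := by
    rw [Subgroup.mem_center_iff]
    intro g
    have := h.isNormalEnd g y
    simp only [MonoidHom.comp_apply, map_mul, map_inv] at this
    rw [← map_mul, hy, map_mul] at this
    rw [← mul_inv_eq_iff_eq_mul, ← this]
    group
  have := mul_mem (h.mul_inv_mem_center y) hn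
  rw [inv_mul_cancel_right, Subgroup.mem_center_iff] at this
  exact this g

/-- Given an isomorphism `θ : K ≃* K'` of finite groups, any isomorphism `e` between the retracts
extends modulo the centre to an isomorphism `K ≃* K'`, as long as the retracts are indecomposable
and `L` is not abelian. -/
theorem exists_mulEquiv_extending [Finite K] [Finite L] [Finite K'] [Finite L']
    (h : IsCentralRetract s p) (h' : IsCentralRetract s' p') (hL : IndecomposableGroup L)
    (hL' : IndecomposableGroup L') (hnc : ∃ x : L, x ∉ Subgroup.center L) (θ : K ≃* K')
    (e : L ≃* L') :
    ∃ β : K ≃* K', ∀ x, β (s x) * (s' (e x))⁻¹ ∈ Subgroup.center K' := by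
  have hab : Function.Bijective ((p'.comp θ.toMonoidHom).comp s) := by
    refine bijective_of_normal_comp (b := (p.comp θ.symm.toMonoidHom).comp s') hL hL' ?_ ?_ ?_
    · exact h'.isNormalEnd.comp_of_leftInverse (s := θ.toMonoidHom.comp s)
        (p := p.comp θ.symm.toMonoidHom) (by simp [h.leftInverse])
    · exact h.isNormalEnd.comp_of_leftInverse (s := θ.symm.toMonoidHom.comp s')
        (p := p'.comp θ.toMonoidHom) (by simp [h'.leftInverse])
    · obtain ⟨x, hx⟩ := hnc
      refine ⟨x, fun hc => hx ?_⟩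
      have hsurj : Function.Surjective (p.comp θ.symm.toMonoidHom) :=
        (Function.LeftInverse.surjective h.leftInverse).comp θ.symm.surjective
      have := h'.map_map_mem_center (y := θ (s x))
        (fun z hz => map_mem_center_of_surjective hsurj hz) hc
      simpa [h.leftInverse] using this
  obtain ⟨a, ha⟩ : ∃ a : L ≃* L', ∀ x, a x = p' (θ (s x)) :=
    ⟨MulEquiv.ofBijective _ hab, fun x => rfl⟩
  have hr : ∀ y, y * (θ (s (a.symm (p' y))))⁻¹ ∈ Subgroup.center K' := by
    intro y
    refine h'.mem_center_of_map ?_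
    rw [map_mul, map_inv, ← ha]
    simp
  let B : K →* K' :=
    { toFun := fun x => θ x * (θ (s (a.symm (p' (θ x)))))⁻¹ * s' (e (p x))
      map_one' := by simp
      map_mul' := by
        intro x y
        have h1 := Subgroup.mem_center_iff.1 (hr (θ y))
        simp only [map_mul, mul_inv_rev]
        obtain ⟨u, hu⟩ : ∃ u, u = (θ (s (a.symm (p' (θ x)))))⁻¹ := ⟨_, rfl⟩
        obtain ⟨v, hv⟩ : ∃ v, v = θ y * (θ (s (a.symm (p' (θ y)))))⁻¹ := ⟨_, rfl⟩
        rw [← hv] at h1 ⊢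
        rw [← hu]
        calc _ = θ x * (v * u) * s' (e (p x)) * s' (e (p y)) := by rw [hv]; group
          _ = θ x * u * (v * s' (e (p x))) * s' (e (p y)) := by rw [← h1 u]; group
          _ = _ := by rw [← h1]; group }
  have hB : ∀ x, B x = θ x * (θ (s (a.symm (p' (θ x)))))⁻¹ * s' (e (p x)) := fun x => rfl
  have hBi : Function.Injective B := by
    rw [injective_iff_map_eq_one]
    intro x hx
    rw [hB] at hx
    have h1 := congrArg p' hx
    simp only [map_mul, map_inv, ← ha, MulEquiv.apply_symm_apply, h'.leftInverse, map_one,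
      mul_inv_cancel, one_mul, EmbeddingLike.map_eq_one_iff] at h1
    rw [h1] at hx
    simp only [map_one, mul_one, mul_inv_eq_one, EmbeddingLike.apply_eq_iff_eq] at hx
    have h2 := congrArg p hx
    rw [h1, h.leftInverse] at h2
    rw [hx, ← h2, map_one]
  have hBb : Function.Bijective B :=
    (Nat.bijective_iff_injective_and_card B).2 ⟨hBi, Nat.card_congr θ.toEquiv⟩
  refine ⟨MulEquiv.ofBijective B hBb, fun x => ?_⟩
  change B (s x) * _ ∈ _
  rw [hB, h.leftInverse, mul_inv_cancel_right]
  exact hr _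

end IsCentralRetract

end

theorem IsInternalDirectProd.exists_isCentralRetract {H : Type*} [Group H] {Z A : Subgroup H}
    (h : IsInternalDirectProd Z A) (hZ : Z ≤ Subgroup.center H) :
    ∃ p : H →* A, IsCentralRetract A.subtype p := by
  obtain ⟨hc, hi, hs⟩ := h
  let f : Z × A →* H := MonoidHom.noncommCoprod Z.subtype A.subtype fun z a => hc z z.2 a a.2
  have hf : ∀ z a, f (z, a) = z * a := fun z a => rfl
  have hb : Function.Bijective f := by
    constructor
    · refine (MonoidHom.noncommCoprod_injective _ _ _).2
        ⟨Z.subtype_injective, A.subtype_injective, ?_⟩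
      rwa [Subgroup.range_subtype, Subgroup.range_subtype, disjoint_iff]
    · rw [← MonoidHom.range_eq_top]
      exact (MonoidHom.noncommCoprod_range _ _ _).trans (by simpa using hs)
  let e := MulEquiv.ofBijective f hb
  have he : ∀ z a, e (z, a) = z * a := fun z a => rfl
  refine ⟨(MonoidHom.snd Z A).comp e.symm.toMonoidHom, fun a => ?_, fun x => ?_⟩
  · have : (a : H) = e (1, a) := by simp [he]
    change (e.symm (a : H)).2 = a
    rw [this, e.symm_apply_apply]
  · obtain ⟨⟨z, a⟩, rfl⟩ := e.surjective x
    change e (z, a) * (((e.symm (e (z, a))).2 : A) : H)⁻¹ ∈ _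
    rw [e.symm_apply_apply, he, mul_inv_cancel_right]
    exact hZ z.2

theorem IsInternalDirectProd.symm {H : Type*} [Group H] {A B : Subgroup H}
    (h : IsInternalDirectProd A B) : IsInternalDirectProd B A :=
  ⟨fun b hb a ha => (h.1 a ha b hb).symm, by rw [inf_comm, h.2.1], by rw [sup_comm, h.2.2]⟩

/-- Regrouping `H = Z × (A × B)` as `(Z × A) × B`. -/
theorem IsInternalDirectProd.regroup {H : Type*} [Group H] {Z C : Subgroup H} {A B : Subgroup C}
    (h : IsInternalDirectProd Z C) (hAB : IsInternalDirectProd A B) :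
    IsInternalDirectProd (Z ⊔ A.map C.subtype) (B.map C.subtype) := by
  obtain ⟨h1, h2, h3⟩ := h
  obtain ⟨k1, k2, k3⟩ := hAB
  have hcent : Z ⊔ A.map C.subtype ≤ Subgroup.centralizer (B.map C.subtype : Set H) := by
    refine sup_le (fun z hz => ?_) ?_
    · rintro _ ⟨b, hb, rfl⟩
      exact (h1 z hz b b.2).symm
    · rintro _ ⟨a, ha, rfl⟩ _ ⟨b, hb, rfl⟩
      exact congrArg Subtype.val (k1 a ha b hb).symm
  refine ⟨fun x hx b hb => (hcent hx b hb).symm, ?_, ?_⟩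
  · rw [eq_bot_iff]
    rintro x ⟨hx, b, hb, rfl⟩
    have hx : C.subtype b ∈ (MonoidHom.noncommCoprod Z.subtype (A.map C.subtype).subtype (by
        rintro ⟨z, hz⟩ ⟨_, a, ha, rfl⟩
        exact h1 z hz a a.2)).range := by
      rw [MonoidHom.noncommCoprod_range]
      simpa using hx
    obtain ⟨⟨⟨z, hz⟩, ⟨_, a, ha, rfl⟩⟩, hza⟩ := hx
    change z * C.subtype a = C.subtype b at hza
    have hzC : z ∈ Z ⊓ C := by
      refine ⟨hz, ?_⟩
      have : z = C.subtype (b * a⁻¹) := by rw [map_mul, map_inv, ← hza]; group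
      rw [this]
      exact (b * a⁻¹).2
    rw [h2, Subgroup.mem_bot] at hzC
    rw [hzC, one_mul] at hza
    have hab : a = b := C.subtype_injective hza
    have : b ∈ A ⊓ B := ⟨hab ▸ ha, hb⟩
    rw [k2, Subgroup.mem_bot] at this
    rw [this, map_one]
    exact one_mem _
  · rw [sup_assoc, ← Subgroup.map_sup, k3, ← MonoidHom.range_eq_map, Subgroup.range_subtype, h3]

theorem QuasiIndecomposable.exists_isCanonicalDecomp {H : Type*} [Group H] [Finite H]
    (hH : QuasiIndecomposable H) : ∃ Z A : Subgroup H, IsCanonicalDecomp Z A := by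
  obtain ⟨⟨Z, C⟩, ⟨hd, hZ⟩, hmin⟩ := exists_minimalFor_of_wellFoundedLT
    (fun x : Subgroup H × Subgroup H => IsInternalDirectProd x.1 x.2 ∧ x.1 ≤ Subgroup.center H)
    (fun x => x.2) ⟨(⊥, ⊤), ⟨by simp, by simp, by simp⟩, bot_le⟩
  have hfactor : ∀ A B : Subgroup C, IsInternalDirectProd A B →
      Z ⊔ A.map C.subtype ≤ Subgroup.center H → A = ⊥ := by
    intro A B hAB hA
    have hle : C ≤ B.map C.subtype :=
      hmin (j := (Z ⊔ A.map C.subtype, B.map C.subtype)) ⟨hd.regroup hAB, hA⟩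
        (Subgroup.map_subtype_le B)
    have hB : B = ⊤ := by
      rw [eq_top_iff]
      intro c _
      obtain ⟨b, hb, hbc⟩ := hle c.2
      rwa [← C.subtype_injective hbc]
    rw [← hAB.2.1, hB, inf_top_eq]
  by_cases hab : ∀ a ∈ C, ∀ b ∈ C, a * b = b * a
  · refine ⟨⊤, ⊥, ⟨by simp, by simp, by simp⟩, ?_, Or.inl rfl⟩
    rw [← hd.2.2]
    refine sup_le hZ fun c hc => ?_
    have : (⊤ : Subgroup H) ≤ Subgroup.centralizer {c} := by
      rw [← hd.2.2]
      refine sup_le (fun z hz => ?_) fun d hd => ?_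
      · rw [Subgroup.mem_centralizer_singleton_iff]
        exact hd.1 z hz c hc
      · rw [Subgroup.mem_centralizer_singleton_iff]
        exact hab d hd c hc
    rw [Subgroup.mem_center_iff]
    exact fun g => Subgroup.mem_centralizer_singleton_iff.1 (this (Subgroup.mem_top g))
  · refine ⟨Z, C, hd, hZ, Or.inr ⟨hab, fun A B hAB => ?_⟩⟩
    rcases hH _ _ (hd.regroup hAB) with h | h
    · exact Or.inl (hfactor A B hAB h)
    · exact Or.inr (hfactor B A hAB.symm (sup_le hZ h))

section Pi

variable {ι : Type*} {H K : ι → Type*} [∀ i, Group (H i)] [∀ i, Group (K i)]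

theorem mem_center_pi_iff {x : ∀ i, H i} :
    x ∈ Subgroup.center (∀ i, H i) ↔ ∀ i, x i ∈ Subgroup.center (H i) := by
  rw [Subgroup.center_pi]
  simp [Subgroup.mem_pi]

/-- The automorphism of `∏ i, H i` sending the `i`-th coordinate to the `σ i`-th one via `b i`. -/
def piPermAut (σ : Equiv.Perm ι) (b : ∀ i, H i ≃* H (σ i)) : MulAut (∀ i, H i) where
  toEquiv := Equiv.piCongr σ fun i => (b i).toEquiv
  map_mul' x y := by
    ext j
    obtain ⟨i, rfl⟩ := σ.surjective j
    change Equiv.piCongr σ (fun i => (b i).toEquiv) (x * y) (σ i) =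
      Equiv.piCongr σ (fun i => (b i).toEquiv) x (σ i) *
        Equiv.piCongr σ (fun i => (b i).toEquiv) y (σ i)
    simp [Equiv.piCongr_apply_apply]

theorem piPermAut_apply (σ : Equiv.Perm ι) (b : ∀ i, H i ≃* H (σ i)) (x : ∀ i, H i) (i : ι) :
    piPermAut σ b x (σ i) = b i (x i) :=
  Equiv.piCongr_apply_apply σ (fun i => (b i).toEquiv) x i

variable [DecidableEq ι]

theorem mulSingle_mem_center {i : ι} {z : H i} (hz : z ∈ Subgroup.center (H i)) :
    Pi.mulSingle i z ∈ Subgroup.center (∀ i, H i) := by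
  rw [mem_center_pi_iff]
  intro j
  rcases eq_or_ne j i with rfl | h
  · simpa using hz
  · simp [h, one_mem]

/-- The matrix entry `K i →* K j` of an endomorphism of `∏ i, H i`, relative to embeddings
`K i →* H i` and projections `H i →* K i`. -/
def piEntry (s : ∀ i, K i →* H i) (p : ∀ i, H i →* K i) (φ : (∀ i, H i) →* ∀ i, H i) (i j : ι) :
    K i →* K j :=
  ((p j).comp ((Pi.evalMonoidHom H j).comp φ)).comp ((MonoidHom.mulSingle H i).comp (s i))

variable {s : ∀ i, K i →* H i} {p : ∀ i, H i →* K i}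

theorem piEntry_apply (φ : (∀ i, H i) →* ∀ i, H i) (i j : ι) (x : K i) :
    piEntry s p φ i j x = p j (φ (Pi.mulSingle i (s i x)) j) := rfl

theorem isNormalEnd_mulSingle_comp_eval {j : ι} {f : H j →* H j} (hf : IsNormalEnd f) :
    IsNormalEnd ((MonoidHom.mulSingle H j).comp (f.comp (Pi.evalMonoidHom H j))) := by
  intro g x
  ext k
  rcases eq_or_ne k j with rfl | h
  · simpa using hf (g k) (x k)
  · simp [h]

theorem isNormalEnd_piEntry_comp (h : ∀ i, IsCentralRetract (s i) (p i))
    {φ ψ : (∀ i, H i) →* ∀ i, H i} (hψ : ∀ x, ψ (φ x) = x) (i j : ι) :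
    IsNormalEnd ((piEntry s p ψ j i).comp (piEntry s p φ i j)) :=
  (isNormalEnd_mulSingle_comp_eval (h j).isNormalEnd).comp_of_leftInverse
    (s := φ.comp ((MonoidHom.mulSingle H i).comp (s i)))
    (p := (p i).comp ((Pi.evalMonoidHom H i).comp ψ)) (by simp [hψ, (h i).leftInverse])

theorem exists_piEntry_notMem_center [Finite ι] (h : ∀ i, IsCentralRetract (s i) (p i))
    {φ ψ : (∀ i, H i) →* ∀ i, H i} (hψ : ∀ x, ψ (φ x) = x) (hs : Function.Surjective ψ)
    {i : ι} {x : K i} (hx : x ∉ Subgroup.center (K i)) :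
    ∃ j, piEntry s p ψ j i (piEntry s p φ i j x) ∉ Subgroup.center (K i) := by
  by_contra! hc
  refine hx ?_
  let F : (∀ i, H i) →* K i := (p i).comp ((Pi.evalMonoidHom H i).comp ψ)
  have hF : Function.Surjective F :=
    (Function.LeftInverse.surjective (h i).leftInverse).comp
      ((Function.surjective_eval i).comp hs)
  have hmem : φ (Pi.mulSingle i (s i x)) ∈ (Subgroup.center (K i)).comap F := by
    refine Subgroup.pi_mem_of_mulSingle_mem _ fun j => ?_
    exact (h j).map_map_mem_center (f := F.comp (MonoidHom.mulSingle H j))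
      (fun z hz => map_mem_center_of_surjective hF (mulSingle_mem_center hz)) (hc j)
  have hFx : F (φ (Pi.mulSingle i (s i x))) = x := by simp [F, hψ, (h i).leftInverse]
  rw [← hFx]
  exact hmem

theorem exists_bijective_piEntry [Finite ι] [∀ i, Finite (K i)]
    (hK : ∀ i, IndecomposableGroup (K i)) (h : ∀ i, IsCentralRetract (s i) (p i))
    (φ : MulAut (∀ i, H i)) {i : ι} (hi : ∃ x, x ∉ Subgroup.center (K i)) :
    ∃ j, Function.Bijective (piEntry s p φ.toMonoidHom i j) := by
  obtain ⟨x, hx⟩ := hi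
  have h1 : ∀ x, φ.symm.toMonoidHom (φ.toMonoidHom x) = x := φ.symm_apply_apply
  have h2 : ∀ x, φ.toMonoidHom (φ.symm.toMonoidHom x) = x := φ.apply_symm_apply
  obtain ⟨j, hj⟩ := exists_piEntry_notMem_center h h1 φ.symm.surjective hx
  exact ⟨j, bijective_of_normal_comp (hK i) (hK j) (isNormalEnd_piEntry_comp h h1 i j)
    (isNormalEnd_piEntry_comp h h2 j i) ⟨x, hj⟩⟩

theorem piEntry_mem_center_of_ne {φ : (∀ i, H i) →* ∀ i, H i} {i i' j : ι}
    (hb : Function.Surjective (piEntry s p φ i j)) (hne : i' ≠ i) (x : K i') :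
    piEntry s p φ i' j x ∈ Subgroup.center (K j) := by
  rw [Subgroup.mem_center_iff]
  intro g
  obtain ⟨y, rfl⟩ := hb g
  have hc := Pi.mulSingle_commute hne.symm (s i y) (s i' x)
  rw [piEntry_apply, piEntry_apply, ← map_mul, ← Pi.mul_apply, ← map_mul, hc.eq, map_mul,
    Pi.mul_apply, map_mul]

theorem exists_perm_bijective_piEntry [Finite ι] [∀ i, Finite (K i)]
    (hK : ∀ i, IndecomposableGroup (K i)) (h : ∀ i, IsCentralRetract (s i) (p i))
    (φ : MulAut (∀ i, H i)) :
    ∃ σ : Equiv.Perm ι, ∀ i,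
      ((∃ x, x ∉ Subgroup.center (K i)) → Function.Bijective (piEntry s p φ.toMonoidHom i (σ i))) ∧
      ((∀ x, x ∈ Subgroup.center (K i)) → σ i = i) := by
  have hτ : ∀ i, ∃ j,
      ((∃ x, x ∉ Subgroup.center (K i)) → Function.Bijective (piEntry s p φ.toMonoidHom i j)) ∧
      ((∀ x, x ∈ Subgroup.center (K i)) → j = i) := by
    intro i
    by_cases hi : ∃ x, x ∉ Subgroup.center (K i)
    · obtain ⟨j, hj⟩ := exists_bijective_piEntry hK h φ hi
      exact ⟨j, fun _ => hj, fun hc => absurd (hc _) hi.choose_spec⟩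
    · exact ⟨i, fun hc => absurd hc hi, fun _ => rfl⟩
  choose τ hτ₁ hτ₂ using hτ
  have hnc : ∀ i, (∃ x, x ∉ Subgroup.center (K i)) → ∃ x, x ∉ Subgroup.center (K (τ i)) := by
    rintro i ⟨x, hx⟩
    by_contra! hc
    have hb := hτ₁ i ⟨x, hx⟩
    refine hx (Subgroup.mem_center_iff.2 fun g => hb.1 ?_)
    rw [map_mul, map_mul, Subgroup.mem_center_iff.1 (hc _)]
  have hinj : Function.Injective τ := by
    intro i i' hii
    by_cases hi : ∃ x, x ∉ Subgroup.center (K i)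
    · by_cases hi' : ∃ x, x ∉ Subgroup.center (K i')
      · by_contra hne
        obtain ⟨z, hz⟩ := hnc i hi
        have hb' := (hτ₁ i' hi').2
        rw [← hii] at hb'
        obtain ⟨y, rfl⟩ := hb' z
        exact hz (piEntry_mem_center_of_ne (hτ₁ i hi).2 (Ne.symm hne) y)
      · have := hnc i hi
        rw [hii, hτ₂ i' (not_exists_not.1 hi')] at this
        exact absurd this hi'
    · by_cases hi' : ∃ x, x ∉ Subgroup.center (K i')
      · have := hnc i' hi'
        rw [← hii, hτ₂ i (not_exists_not.1 hi)] at this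
        exact absurd this hi
      · rwa [hτ₂ i (not_exists_not.1 hi), hτ₂ i' (not_exists_not.1 hi')] at hii
  exact ⟨Equiv.ofBijective τ (Finite.injective_iff_bijective.1 hinj), fun i => ⟨hτ₁ i, hτ₂ i⟩⟩

theorem piPermAut_mulSingle (σ : Equiv.Perm ι) (b : ∀ i, H i ≃* H (σ i)) (i : ι) (x : H i) :
    piPermAut σ b (Pi.mulSingle i x) = Pi.mulSingle (σ i) (b i x) := by
  ext j
  obtain ⟨k, rfl⟩ := σ.surjective j
  rw [piPermAut_apply]
  rcases eq_or_ne k i with rfl | h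
  · simp
  · simp [h]

/-- If `φ` agrees with a factor-permuting automorphism modulo the centre on the images of the
`K i`, then it does so everywhere. -/
theorem inv_mul_mem_center_of_piEntry [Finite ι] (h : ∀ i, IsCentralRetract (s i) (p i))
    (φ : MulAut (∀ i, H i)) (σ : Equiv.Perm ι) (b : ∀ i, H i ≃* H (σ i))
    (hdiag : ∀ i x, p (σ i) (b i (s i x)) * (piEntry s p φ.toMonoidHom i (σ i) x)⁻¹ ∈
      Subgroup.center (K (σ i)))
    (hoff : ∀ i j, j ≠ σ i → ∀ x, piEntry s p φ.toMonoidHom i j x ∈ Subgroup.center (K j))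
    (x : ∀ i, H i) : (piPermAut σ b x)⁻¹ * φ x ∈ Subgroup.center (∀ i, H i) := by
  let q := QuotientGroup.mk' (Subgroup.center (∀ i, H i))
  suffices hx : x ∈ (q.comp (piPermAut σ b).toMonoidHom).eqLocus (q.comp φ.toMonoidHom) from
    QuotientGroup.eq.1 hx
  have hcent : ∀ z ∈ Subgroup.center (∀ i, H i),
      z ∈ (q.comp (piPermAut σ b).toMonoidHom).eqLocus (q.comp φ.toMonoidHom) := by
    intro z hz
    refine QuotientGroup.eq.2 (mul_mem (inv_mem ?_) ?_)
    · exact map_mem_center_of_surjective (piPermAut σ b).surjective hz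
    · exact map_mem_center_of_surjective φ.surjective hz
  refine Subgroup.pi_mem_of_mulSingle_mem x fun i => ?_
  have hx : Pi.mulSingle i (x i) = Pi.mulSingle i (x i * (s i (p i (x i)))⁻¹) *
      (Pi.mulSingle i (s i (p i (x i))) : ∀ i, H i) := by
    rw [← Pi.mulSingle_mul, inv_mul_cancel_right]
  rw [hx]
  refine mul_mem (hcent _ (mulSingle_mem_center ((h i).mul_inv_mem_center _))) ?_
  generalize p i (x i) = y
  refine QuotientGroup.eq.2 (mem_center_pi_iff.2 fun j => (h j).mem_center_of_map ?_)
  change p j ((piPermAut σ b (Pi.mulSingle i (s i y)) j)⁻¹ * φ (Pi.mulSingle i (s i y)) j) ∈ _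
  rw [piPermAut_mulSingle, map_mul, map_inv]
  rcases eq_or_ne j (σ i) with rfl | hj
  · rw [Pi.mulSingle_eq_same]
    have h1 := inv_mem (hdiag i y)
    rw [mul_inv_rev, inv_inv, piEntry_apply] at h1
    have h2 := Subgroup.Normal.conj_mem inferInstance _ h1 (p (σ i) (b i (s i y)))⁻¹
    simpa [mul_assoc] using h2
  · rw [Pi.mulSingle_eq_of_ne hj]
    rw [map_one, inv_one, one_mul]
    exact hoff i j hj y

end Pi

theorem piFactor_eq_range {n : ℕ} (H : Fin n → Type*) [∀ i, Group (H i)] (i : Fin n) :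
    piFactor H i = (MonoidHom.mulSingle H i).range := by
  ext f
  constructor
  · intro hf
    refine ⟨f i, funext fun j => ?_⟩
    rcases eq_or_ne j i with rfl | hj
    · simp
    · simp [hj, hf j hj]
  · rintro ⟨x, rfl⟩ j hj
    simp [hj]

theorem map_piFactor_piPermAut {n : ℕ} {H : Fin n → Type*} [∀ i, Group (H i)]
    (σ : Equiv.Perm (Fin n)) (b : ∀ i, H i ≃* H (σ i)) (i : Fin n) :
    (piFactor H i).map (piPermAut σ b).toMonoidHom = piFactor H (σ i) := by
  rw [piFactor_eq_range, piFactor_eq_range, MonoidHom.map_range]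
  ext f
  constructor
  · rintro ⟨x, rfl⟩
    exact ⟨b i x, (piPermAut_mulSingle σ b i x).symm⟩
  · rintro ⟨x, rfl⟩
    obtain ⟨y, rfl⟩ := (b i).surjective x
    exact ⟨y, piPermAut_mulSingle σ b i y⟩

/-- **Theorem 17 (Marin–Michel).** Let `G = G₁ × … × Gₙ` be a direct product of finite
quasi-indecomposable groups such that `can(Gᵢ) ≅ can(Gⱼ)` implies `Gᵢ ≅ Gⱼ`.  Then every
automorphism of `G` is of the form `α ∘ β` with `α` a central automorphism and `β`
permuting the factors `Gᵢ`. -/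
theorem automorphisms_of_product_of_quasi_indecomposables
    (n : ℕ) (H : Fin n → Type) [∀ i, Group (H i)] [∀ i, Finite (H i)]
    (hqi : ∀ i, QuasiIndecomposable (H i))
    (hcan : ∀ i j, ∀ (Zi : Subgroup (H i)) (Hi : Subgroup (H i))
        (Zj : Subgroup (H j)) (Hj : Subgroup (H j)),
      IsCanonicalDecomp Zi Hi → IsCanonicalDecomp Zj Hj →
      Nonempty (↥Hi ≃* ↥Hj) → Nonempty (H i ≃* H j)) :
    ∀ φ : MulAut (∀ i, H i),
      ∃ (α β : MulAut (∀ i, H i)) (σ : Equiv.Perm (Fin n)),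
        IsCentralAut α ∧
        (∀ i, (piFactor H i).map β.toMonoidHom = piFactor H (σ i)) ∧
        φ = α * β := by
  classical
  choose Z A hA using fun i => (hqi i).exists_isCanonicalDecomp
  choose p hp using fun i => (hA i).1.exists_isCentralRetract (hA i).2.1
  have hind : ∀ i, IndecomposableGroup (A i) := fun i => by
    rcases (hA i).2.2 with h | h
    · have : Subsingleton (A i) := by rw [h]; infer_instance
      exact fun B _ _ => Or.inl (Subsingleton.elim B ⊥)
    · exact h.2
  have htriv : ∀ i, (∀ x, x ∈ Subgroup.center (A i)) → Subsingleton (A i) := fun i hc => by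
    rcases (hA i).2.2 with h | h
    · rw [h]; infer_instance
    · exact absurd (fun a ha b hb =>
        congrArg Subtype.val (Subgroup.mem_center_iff.1 (hc ⟨b, hb⟩) ⟨a, ha⟩)) h.1
  intro φ
  obtain ⟨σ, hσ⟩ := exists_perm_bijective_piEntry hind hp φ
  have hb : ∀ i, ∃ b : H i ≃* H (σ i), ∀ x : A i,
      p (σ i) (b x) * (piEntry (fun i => (A i).subtype) p φ.toMonoidHom i (σ i) x)⁻¹ ∈
        Subgroup.center (A (σ i)) := by
    intro i
    by_cases hi : ∃ x, x ∉ Subgroup.center (A i)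
    · let e := MulEquiv.ofBijective _ ((hσ i).1 hi)
      obtain ⟨θ⟩ := hcan i (σ i) _ _ _ _ (hA i) (hA (σ i)) ⟨e⟩
      obtain ⟨b, hb⟩ := (hp i).exists_mulEquiv_extending (hp (σ i)) (hind i) (hind _) hi θ e
      refine ⟨b, fun x => ?_⟩
      have := map_mem_center_of_surjective
        (Function.LeftInverse.surjective (hp (σ i)).leftInverse) (hb x)
      rwa [map_mul, map_inv, (hp (σ i)).leftInverse] at this
    · have := htriv i (not_exists_not.1 hi)
      rw [(hσ i).2 (not_exists_not.1 hi)]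
      exact ⟨MulEquiv.refl _, fun x => by rw [Subsingleton.elim (_ * _) 1]; exact one_mem _⟩
  choose b hb using hb
  have hoff : ∀ i j, j ≠ σ i → ∀ x,
      piEntry (fun i => (A i).subtype) p φ.toMonoidHom i j x ∈ Subgroup.center (A j) := by
    intro i j hj x
    obtain ⟨k, rfl⟩ := σ.surjective j
    have hk : i ≠ k := fun h => hj (h ▸ rfl)
    by_cases hi : ∃ x, x ∉ Subgroup.center (A k)
    · exact piEntry_mem_center_of_ne ((hσ k).1 hi).2 hk x
    · have hc := not_exists_not.1 hi
      rw [(hσ k).2 hc]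
      exact hc _
  refine ⟨φ * (piPermAut σ b)⁻¹, piPermAut σ b, σ, fun g => ?_, map_piFactor_piPermAut σ b, ?_⟩
  · have := inv_mul_mem_center_of_piEntry hp φ σ b hb hoff ((piPermAut σ b)⁻¹ g)
    rwa [MulAut.apply_inv_self] at this
  · rw [inv_mul_cancel_right]
end

section
/- Let G be a finite group and K a field of characteristic 0. Let ρ′ be a finite-dimensional representation of G defined over K and let ρ be an absolutely irreducible representation of G, with character χ taking values in K, which occurs with multiplicity exactly one in ρ′ (over an algebraic closure). Then: (1) ρ admits a model over K; (2) if γ is a field automorphism of K and a ∈ Aut(G) satisfy γ ∘ ρ′ = ρ′ ∘ a and γ ∘ χ = χ ∘ a, then ρ admits a model over K such that γ ∘ ρ = ρ ∘ a; (3) if j : Gal(K/ℚ) → Aut(G) is a homomorphism (K Galois over ℚ) such that γ ∘ ρ′ = ρ′ ∘ j(γ) and γ ∘ χ = χ ∘ j(γ) for all γ, then ρ admits a j-equivariant model over K, i.e. a model with γ ∘ ρ = ρ ∘ j(γ) for all γ ∈ Gal(K/ℚ). -/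
/-- A matrix representation is irreducible. -/
def IsIrredMatrixRep {H : Type*} [Group H] {n : ℕ} {𝕜 : Type*} [Field 𝕜]
    (ρ : H →* Matrix.GeneralLinearGroup (Fin n) 𝕜) : Prop :=
  0 < n ∧
    ∀ U : Submodule 𝕜 (Fin n → 𝕜),
      (∀ h : H, U.map (Matrix.toLin' (ρ h).val) ≤ U) → U = ⊥ ∨ U = ⊤

/-- The space of intertwiners between (the base change to `L` of) a representation `ρ'`
over `K` and a representation `ρ` over `L`. -/
def intertwiners {G K L : Type*} [Group G] [Field K] [Field L] [Algebra K L]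
    {N m : ℕ} (ρ' : G →* Matrix.GeneralLinearGroup (Fin N) K)
    (ρ : G →* Matrix.GeneralLinearGroup (Fin m) L) :
    Submodule L (Matrix (Fin N) (Fin m) L) where
  carrier := {X | ∀ g : G, ((ρ' g).val.map (algebraMap K L)) * X = X * (ρ g).val}
  add_mem' := by
    intro a b ha hb g
    simp [Matrix.mul_add, Matrix.add_mul, ha g, hb g]
  zero_mem' := by intro g; simp
  smul_mem' := by
    intro c a ha g
    simp [Matrix.mul_smul, Matrix.smul_mul, ha g]

/-- The sum of `R g * M * S g⁻¹` over the group intertwines `R` and `S`. -/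
theorem mul_sum_conj_eq_sum_conj_mul {G L : Type*} [Group G] [Fintype G] [Field L] {N m : ℕ}
    (R : G →* Matrix (Fin N) (Fin N) L) (S : G →* Matrix (Fin m) (Fin m) L)
    (M : Matrix (Fin N) (Fin m) L) (h : G) :
    R h * ∑ g, R g * M * S g⁻¹ = (∑ g, R g * M * S g⁻¹) * S h := by
  rw [Matrix.mul_sum, Matrix.sum_mul]
  refine Fintype.sum_equiv (Equiv.mulLeft h) _ _ fun g => ?_
  simp only [Equiv.coe_mulLeft, mul_inv_rev, Matrix.mul_assoc, ← map_mul]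
  simp [Matrix.mul_assoc]

theorem mul_single_mul_apply {L : Type*} [Field L] {N m : ℕ}
    (A : Matrix (Fin N) (Fin N) L) (B : Matrix (Fin m) (Fin m) L)
    (i k : Fin N) (j l : Fin m) :
    (A * Matrix.single i j (1 : L) * B) k l = A k i * B j l := by
  rw [Matrix.mul_assoc, Matrix.mul_apply, Finset.sum_eq_single i]
  · simp
  · intro b _ hb
    simp [hb]
  · simp

/-- **Schur's lemma**: over an algebraically closed field, a matrix commuting with an irreducible
representation is scalar. -/
theorem IsIrredMatrixRep.exists_eq_smul_one {G L : Type*} [Group G] [Field L] [IsAlgClosed L]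
    {m : ℕ} {ρ : G →* Matrix.GeneralLinearGroup (Fin m) L} (hρ : IsIrredMatrixRep ρ)
    (M : Matrix (Fin m) (Fin m) L) (hM : ∀ g, (ρ g).val * M = M * (ρ g).val) :
    ∃ c : L, M = c • (1 : Matrix (Fin m) (Fin m) L) := by
  have : Nonempty (Fin m) := ⟨⟨0, hρ.1⟩⟩
  obtain ⟨c, hc⟩ := Module.End.exists_eigenvalue (Matrix.toLin' M)
  refine ⟨c, ?_⟩
  have htop : Module.End.eigenspace (Matrix.toLin' M) c = ⊤ := by
    refine (hρ.2 _ fun h => ?_).resolve_left hc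
    rintro _ ⟨v, hv, rfl⟩
    simp only [SetLike.mem_coe, Module.End.mem_eigenspace_iff, Matrix.toLin'_apply] at hv ⊢
    rw [Matrix.mulVec_mulVec, ← hM, ← Matrix.mulVec_mulVec, hv, Matrix.mulVec_smul]
  ext k i
  have h : Matrix.toLin' M (Pi.single i 1) = c • Pi.single i 1 :=
    Module.End.mem_eigenspace_iff.mp (htop ▸ Submodule.mem_top)
  simpa [Matrix.one_apply, Pi.single_apply] using congrFun h k

/-- **Schur orthogonality** of the matrix coefficients of an irreducible representation. -/
theorem IsIrredMatrixRep.natCast_mul_sum_apply_mul_apply_inv {G L : Type*} [Group G] [Fintype G]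
    [Field L] [IsAlgClosed L] {m : ℕ} {ρ : G →* Matrix.GeneralLinearGroup (Fin m) L}
    (hρ : IsIrredMatrixRep ρ) (i j k l : Fin m) :
    (m : L) * ∑ g, (ρ g).val k i * (ρ g⁻¹).val j l =
      Fintype.card G * ((1 : Matrix (Fin m) (Fin m) L) k l * (1 : Matrix (Fin m) (Fin m) L) j i) := by
  let S : G →* Matrix (Fin m) (Fin m) L := (Units.coeHom _).comp ρ
  have hS (g : G) : S g = (ρ g).val := rfl
  obtain ⟨c, hc⟩ := hρ.exists_eq_smul_one (∑ g, S g * Matrix.single i j (1 : L) * S g⁻¹)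
    fun g => mul_sum_conj_eq_sum_conj_mul S S _ g
  have htr := congrArg Matrix.trace hc
  have hterm (g : G) : Matrix.trace (S g * Matrix.single i j (1 : L) * S g⁻¹) =
      (1 : Matrix (Fin m) (Fin m) L) j i := by
    rw [Matrix.trace_mul_comm, ← Matrix.mul_assoc, ← map_mul]
    by_cases h : i = j
    · subst h; simp
    · simp [h, Ne.symm h]
  rw [Matrix.trace_sum, Finset.sum_congr rfl fun g _ => hterm g] at htr
  simp only [Finset.sum_const, Finset.card_univ, nsmul_eq_mul, Matrix.trace_smul,
    Matrix.trace_one, Fintype.card_fin, smul_eq_mul] at htr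
  have hkl := congrFun (congrFun hc k) l
  rw [Matrix.sum_apply] at hkl
  simp only [mul_single_mul_apply, Matrix.smul_apply, smul_eq_mul] at hkl
  simp only [← hS]
  rw [hkl, mul_left_comm ((Fintype.card G : ℕ) : L), htr]
  ring

/-- If `ρ` is irreducible of multiplicity one in `R`, spanned by the intertwiner `X`, then the
isotypic projector attached to `ρ` is `X * Z` for a left inverse `Z` of `X`. -/
theorem IsIrredMatrixRep.exists_left_inverse_projector_eq {G L : Type*} [Group G] [Fintype G]
    [Field L] [CharZero L] [IsAlgClosed L] {N m : ℕ} {ρ : G →* Matrix.GeneralLinearGroup (Fin m) L}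
    (hρ : IsIrredMatrixRep ρ) (R : G →* Matrix (Fin N) (Fin N) L)
    {X : Matrix (Fin N) (Fin m) L} (hX0 : X ≠ 0) (hX : ∀ g, R g * X = X * (ρ g).val)
    (hspan : ∀ T : Matrix (Fin N) (Fin m) L, (∀ g, R g * T = T * (ρ g).val) → ∃ c : L, c • X = T) :
    ∃ Z : Matrix (Fin m) (Fin N) L, Z * X = 1 ∧
      ((m : L) / Fintype.card G) • ∑ g, Matrix.trace (ρ g⁻¹).val • R g = X * Z := by
  let S : G →* Matrix (Fin m) (Fin m) L := (Units.coeHom _).comp ρ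
  have hS (g : G) : S g = (ρ g).val := rfl
  choose Y hY using fun (j : Fin m) (i : Fin N) =>
    hspan _ (mul_sum_conj_eq_sum_conj_mul R S (Matrix.single i j 1))
  have hcoeff (j : Fin m) (i k : Fin N) (l : Fin m) :
      ∑ g, R g k i * S g⁻¹ j l = Y j i * X k l := by
    have := congrFun (congrFun (hY j i) k) l
    rw [Matrix.sum_apply] at this
    simpa only [mul_single_mul_apply, Matrix.smul_apply, smul_eq_mul] using this.symm
  have hG : (Fintype.card G : L) ≠ 0 := Nat.cast_ne_zero.mpr Fintype.card_ne_zero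
  refine ⟨((m : L) / Fintype.card G) • Matrix.of Y, ?_, ?_⟩
  · obtain ⟨k, l, hkl⟩ : ∃ k l, X k l ≠ 0 := by
      by_contra! h
      exact hX0 (Matrix.ext h)
    ext j i
    have h1 : X k l * (Matrix.of Y * X) j i = ∑ r, X k r * ∑ g, S g r i * S g⁻¹ j l := by
      calc _ = ∑ s, (Y j s * X k l) * X s i := by
            rw [Matrix.mul_apply, Finset.mul_sum]
            exact Finset.sum_congr rfl fun s _ => by simp only [Matrix.of_apply]; ring
        _ = ∑ g, (R g * X) k i * S g⁻¹ j l := by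
            simp only [← hcoeff, Matrix.mul_apply, Finset.sum_mul]
            rw [Finset.sum_comm]
            exact Finset.sum_congr rfl fun g _ => Finset.sum_congr rfl fun s _ => by ring
        _ = ∑ g, (X * S g) k i * S g⁻¹ j l := by simp only [hX, hS]
        _ = _ := by
            simp only [Matrix.mul_apply, Finset.sum_mul, Finset.mul_sum]
            rw [Finset.sum_comm]
            exact Finset.sum_congr rfl fun g _ => Finset.sum_congr rfl fun s _ => by ring
    have h2 : (m : L) * (X k l * (Matrix.of Y * X) j i) =
        Fintype.card G * (X k l * (1 : Matrix (Fin m) (Fin m) L) j i) := by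
      rw [h1, Finset.mul_sum]
      simp only [mul_left_comm (m : L), hS, hρ.natCast_mul_sum_apply_mul_apply_inv]
      rw [Finset.sum_eq_single l]
      · simp; ring
      · intro r _ hr
        simp [Matrix.one_apply_ne hr]
      · simp
    rw [Matrix.smul_mul, Matrix.smul_apply, smul_eq_mul, div_mul_eq_mul_div, div_eq_iff hG]
    refine mul_left_cancel₀ hkl ?_
    linear_combination h2
  · rw [Matrix.mul_smul]
    congr 1
    ext k i
    rw [Matrix.sum_apply, Matrix.mul_apply]
    simp only [Matrix.of_apply, mul_comm (X k _), ← hcoeff, Matrix.smul_apply, smul_eq_mul]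
    rw [Finset.sum_comm]
    refine Finset.sum_congr rfl fun g _ => ?_
    rw [← Finset.mul_sum, mul_comm]
    rfl

/-- An idempotent matrix over a field has a full rank factorisation. -/
theorem exists_factorization_of_isIdempotentElem {F : Type*} [Field F] {N : ℕ}
    {p : Matrix (Fin N) (Fin N) F} (hp : IsIdempotentElem p) :
    ∃ (r : ℕ) (B : Matrix (Fin N) (Fin r) F) (C : Matrix (Fin r) (Fin N) F),
      B * C = p ∧ C * B = 1 := by
  let f := Matrix.toLin' p
  have hf (v : Fin N → F) : f (f v) = f v := by
    simp only [f, Matrix.toLin'_apply, Matrix.mulVec_mulVec, hp.eq]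
  let b := Module.finBasis F (LinearMap.range f)
  let e := Pi.basisFun F (Fin N)
  refine ⟨_, LinearMap.toMatrix b e (LinearMap.range f).subtype,
    LinearMap.toMatrix e b f.rangeRestrict, ?_, ?_⟩
  · rw [← LinearMap.toMatrix_comp]
    have : (LinearMap.range f).subtype ∘ₗ f.rangeRestrict = f := rfl
    rw [this]
    exact LinearMap.toMatrix'_toLin' p
  · rw [← LinearMap.toMatrix_comp]
    have : f.rangeRestrict ∘ₗ (LinearMap.range f).subtype = LinearMap.id := by
      ext ⟨_, v, rfl⟩ : 2
      exact hf v
    rw [this, LinearMap.toMatrix_id]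

/-- A multiplicity one constituent with character `x` in `K` of a representation `ρ'` over `K` has a
model over `K` that is compatible with all semilinear symmetries of the pair `(ρ', x)`. -/
theorem exists_equivariant_model {G K L : Type*} [Group G] [Fintype G] [Field K] [CharZero K]
    [Field L] [IsAlgClosed L] [Algebra K L] {N m : ℕ}
    (ρ' : G →* Matrix.GeneralLinearGroup (Fin N) K) {ρ : G →* Matrix.GeneralLinearGroup (Fin m) L}
    (hρ : IsIrredMatrixRep ρ) (x : G → K)
    (hx : ∀ g, Matrix.trace (ρ g).val = algebraMap K L (x g))
    (hmult : Module.finrank L (intertwiners ρ' ρ) = 1) :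
    ∃ (τ : G →* Matrix.GeneralLinearGroup (Fin m) K) (P : Matrix.GeneralLinearGroup (Fin m) L),
      (∀ g, (τ g).val.map (algebraMap K L) = (P * ρ g * P⁻¹).val) ∧
      ∀ (γ : K ≃+* K) (a : MulAut G), (∀ g, (ρ' (a g)).val = (ρ' g).val.map γ) →
        (∀ g, x (a g) = γ (x g)) → ∀ g, (τ (a g)).val = (τ g).val.map γ := by
  have : CharZero L := charZero_of_injective_algebraMap (algebraMap K L).injective
  let φ : Matrix (Fin N) (Fin N) K →+* Matrix (Fin N) (Fin N) L := (algebraMap K L).mapMatrix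
  let R' : G →* Matrix (Fin N) (Fin N) K := (Units.coeHom _).comp ρ'
  let R : G →* Matrix (Fin N) (Fin N) L := (φ : _ →* _).comp R'
  obtain ⟨⟨X, hX⟩, hX0, hspan⟩ := finrank_eq_one_iff'.mp hmult
  obtain ⟨Z, hZX, hXZ⟩ := hρ.exists_left_inverse_projector_eq R
    (fun h => hX0 (Subtype.ext h)) hX fun T hT => by
      obtain ⟨c, hc⟩ := hspan ⟨T, hT⟩
      exact ⟨c, congrArg Subtype.val hc⟩
  let p : Matrix (Fin N) (Fin N) K := ((m : K) / Fintype.card G) • ∑ g, x g⁻¹ • R' g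
  have hφsmul (c : K) (M : Matrix (Fin N) (Fin N) K) : φ (c • M) = algebraMap K L c • φ M := by
    ext i j
    simp [φ]
  have hpL : φ p = X * Z := by
    rw [← hXZ]
    simp only [p, hφsmul, map_sum, hx, map_div₀, map_natCast]
    rfl
  have hφinj : Function.Injective φ := Matrix.map_injective (algebraMap K L).injective
  have hpidem : p * p = p := by
    apply hφinj
    rw [map_mul, hpL, Matrix.mul_assoc, ← Matrix.mul_assoc Z, hZX, Matrix.one_mul]
  have hxconj (h g : G) : x (h * g * h⁻¹) = x g := by
    apply (algebraMap K L).injective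
    rw [← hx, ← hx, map_mul, Units.val_mul, Matrix.trace_mul_comm, ← Units.val_mul, ← map_mul,
      inv_mul_cancel_left]
  have hpcomm (h : G) : R' h * p = p * R' h := by
    simp only [p, Matrix.mul_smul, Matrix.smul_mul, Matrix.mul_sum, Matrix.sum_mul]
    congr 1
    refine Fintype.sum_equiv (MulAut.conj h).toEquiv _ _ fun g => ?_
    change x g⁻¹ • (R' h * R' g) = x (h * g * h⁻¹)⁻¹ • (R' (h * g * h⁻¹) * R' h)
    simp only [conj_inv, hxconj, ← map_mul, inv_mul_cancel_right]
  let F : Subfield K := ⨅ γ ∈ {γ : K ≃+* K | ∃ a : MulAut G,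
    (∀ g, (ρ' (a g)).val = (ρ' g).val.map γ) ∧ ∀ g, x (a g) = γ (x g)},
    (γ : K →+* K).eqLocusField (RingHom.id K)
  have hpF (i j : Fin N) : p i j ∈ F := by
    simp only [F, Subfield.mem_iInf]
    rintro γ ⟨a, ha, hxa⟩
    change γ (p i j) = p i j
    simp only [p, Matrix.smul_apply, Matrix.sum_apply, smul_eq_mul, map_mul, map_sum, map_div₀,
      map_natCast]
    congr 1
    refine Fintype.sum_equiv a.toEquiv _ _ fun g => ?_
    rw [← hxa, map_inv]
    congr 1
    exact (congrFun (congrFun (ha g) i) j).symm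
  let p₀ : Matrix (Fin N) (Fin N) F := Matrix.of fun i j => ⟨p i j, hpF i j⟩
  have hp₀ : p₀.map F.subtype = p := rfl
  have hp₀idem : IsIdempotentElem p₀ := by
    apply Matrix.map_injective F.subtype.injective
    simp only [Matrix.map_mul, hp₀, hpidem]
  obtain ⟨r, B₀, C₀, hBC₀, hCB₀⟩ := exists_factorization_of_isIdempotentElem hp₀idem
  let B := B₀.map F.subtype
  let C := C₀.map F.subtype
  have hBC : B * C = p := by rw [← hp₀, ← hBC₀, Matrix.map_mul]
  have hCB : C * B = 1 := by
    rw [← Matrix.map_mul, hCB₀, Matrix.map_one _ (map_zero _) (map_one _)]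
  let BL := B.map (algebraMap K L)
  let CL := C.map (algebraMap K L)
  have hBCL : BL * CL = X * Z := by rw [← hpL, ← hBC, ← Matrix.map_mul]; rfl
  have hCBL : CL * BL = 1 := by
    rw [← Matrix.map_mul, hCB, Matrix.map_one _ (map_zero _) (map_one _)]
  have hrm : r = m := by
    have h1 := congrArg Matrix.trace hCBL
    rw [Matrix.trace_mul_comm, hBCL, Matrix.trace_mul_comm, hZX] at h1
    simpa using h1.symm
  subst hrm
  let σ : G →* Matrix (Fin r) (Fin r) K :=
    { toFun := fun g => C * R' g * B
      map_one' := by rw [map_one, Matrix.mul_one, hCB]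
      map_mul' := fun g h => by
        calc C * R' (g * h) * B = C * B * C * (R' g * R' h) * B := by
              rw [hCB, Matrix.one_mul, map_mul]
          _ = C * (p * R' g) * R' h * B := by rw [← hBC]; simp only [Matrix.mul_assoc]
          _ = C * R' g * B * (C * R' h * B) := by
              rw [← hpcomm, ← hBC]; simp only [Matrix.mul_assoc] }
  have hPinv : CL * X * (Z * BL) = 1 := by
    calc CL * X * (Z * BL) = CL * (X * Z) * BL := by simp only [Matrix.mul_assoc]
      _ = (CL * BL) * (CL * BL) := by rw [← hBCL]; simp only [Matrix.mul_assoc]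
      _ = 1 := by rw [hCBL, Matrix.one_mul]
  let P : Matrix.GeneralLinearGroup (Fin r) L :=
    ⟨CL * X, Z * BL, hPinv, mul_eq_one_comm.mp hPinv⟩
  refine ⟨σ.toHomUnits, P, fun g => ?_, fun γ a ha hxa g => ?_⟩
  · rw [Units.val_mul, Units.val_mul]
    change (C * R' g * B).map (algebraMap K L) = CL * X * (ρ g).val * (Z * BL)
    rw [Matrix.map_mul, Matrix.map_mul]
    change CL * R g * BL = _
    have hXg : R g * X = X * (ρ g).val := hX g
    have hcomm : R g * (X * Z) = X * Z * R g := by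
      rw [← hpL]
      exact (map_mul φ _ _).symm.trans ((congrArg φ (hpcomm g)).trans (map_mul φ _ _))
    calc CL * R g * BL = CL * R g * (BL * CL) * BL := by
          rw [Matrix.mul_assoc, Matrix.mul_assoc, Matrix.mul_assoc BL, hCBL, Matrix.mul_one,
            Matrix.mul_assoc]
      _ = CL * (R g * X) * (Z * BL) := by rw [hBCL]; simp only [Matrix.mul_assoc]
      _ = _ := by rw [hXg]; simp only [Matrix.mul_assoc]
  · have hfix (y : F) : γ y = y := by
      have hy := y.2
      simp only [F, Subfield.mem_iInf] at hy
      exact hy γ ⟨a, ha, hxa⟩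
    have hB : B.map γ = B := by ext i j; exact hfix _
    have hC : C.map γ = C := by ext i j; exact hfix _
    change C * (ρ' (a g)).val * B = (C * (ρ' g).val * B).map γ
    rw [Matrix.map_mul, Matrix.map_mul, hB, hC, ha]

/-- **Lemma 18 (Marin–Michel, "multiplicity free" lemma).** Let `G` be a finite group, `K`
a field of characteristic `0` with algebraic closure `L`, `ρ'` a finite-dimensional
representation of `G` over `K`, and `ρ` an absolutely irreducible representation of `G`
(over `L`) with character `χ` taking values in `K`, occurring with multiplicity exactly
one in `ρ'`.  Then (1) `ρ` admits a model over `K`; (2) if `γ ∘ ρ' = ρ' ∘ a` and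
`γ ∘ χ = χ ∘ a` for a field automorphism `γ` of `K` and `a ∈ Aut(G)`, the model can be
chosen with `γ ∘ ρ = ρ ∘ a`; (3) if `j : Gal(K/ℚ) → Aut(G)` satisfies
`γ ∘ ρ' = ρ' ∘ j(γ)` and `γ ∘ χ = χ ∘ j(γ)` for all `γ`, then `ρ` admits a
`j`-equivariant model over `K`. -/
theorem multiplicity_free_descent
    (G : Type) [Group G] [Finite G]
    (K : Type) [Field K] [CharZero K]
    {N m : ℕ}
    (ρ' : G →* Matrix.GeneralLinearGroup (Fin N) K)
    (ρ : G →* Matrix.GeneralLinearGroup (Fin m) (AlgebraicClosure K))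
    (hρ : IsIrredMatrixRep ρ)
    -- the character of `ρ` takes values in `K`:
    (hχK : ∀ g : G, ∃ x : K,
      Matrix.trace (ρ g).val = algebraMap K (AlgebraicClosure K) x)
    -- `ρ` occurs with multiplicity exactly one in `ρ'` over the algebraic closure:
    (hmult : Module.finrank (AlgebraicClosure K) ↥(intertwiners ρ' ρ) = 1) :
    -- (1) `ρ` admits a model over `K`:
    (∃ (τ : G →* Matrix.GeneralLinearGroup (Fin m) K)
        (P : Matrix.GeneralLinearGroup (Fin m) (AlgebraicClosure K)),
      ∀ g : G, (τ g).val.map (algebraMap K (AlgebraicClosure K)) = (P * ρ g * P⁻¹).val) ∧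
    -- (2) equivariance w.r.t. a single pair `(γ, a)`:
    (∀ (γ : K ≃+* K) (a : MulAut G),
      (∀ g : G, (ρ' (a g)).val = (ρ' g).val.map (fun x => γ x)) →
      (∀ (g : G) (x : K), Matrix.trace (ρ g).val = algebraMap K (AlgebraicClosure K) x →
        Matrix.trace (ρ (a g)).val = algebraMap K (AlgebraicClosure K) (γ x)) →
      ∃ (τ : G →* Matrix.GeneralLinearGroup (Fin m) K)
          (P : Matrix.GeneralLinearGroup (Fin m) (AlgebraicClosure K)),
        (∀ g : G,
          (τ g).val.map (algebraMap K (AlgebraicClosure K)) = (P * ρ g * P⁻¹).val) ∧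
        (∀ g : G, (τ (a g)).val = (τ g).val.map (fun x => γ x))) ∧
    -- (3) `j`-equivariant models, for `K` Galois over `ℚ`:
    (∀ _ : IsGalois ℚ K, ∀ j : (K ≃ₐ[ℚ] K) →* MulAut G,
      (∀ (γ : K ≃ₐ[ℚ] K) (g : G), (ρ' (j γ g)).val = (ρ' g).val.map (fun x => γ x)) →
      (∀ (γ : K ≃ₐ[ℚ] K) (g : G) (x : K),
        Matrix.trace (ρ g).val = algebraMap K (AlgebraicClosure K) x →
        Matrix.trace (ρ (j γ g)).val = algebraMap K (AlgebraicClosure K) (γ x)) →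
      ∃ (τ : G →* Matrix.GeneralLinearGroup (Fin m) K)
          (P : Matrix.GeneralLinearGroup (Fin m) (AlgebraicClosure K)),
        (∀ g : G,
          (τ g).val.map (algebraMap K (AlgebraicClosure K)) = (P * ρ g * P⁻¹).val) ∧
        (∀ (γ : K ≃ₐ[ℚ] K) (g : G), (τ (j γ g)).val = (τ g).val.map (fun x => γ x))) := by
  have : Fintype G := Fintype.ofFinite G
  choose x hx using hχK
  obtain ⟨τ, P, hP, hτ⟩ := exists_equivariant_model ρ' hρ x hx hmult
  refine ⟨⟨τ, P, hP⟩, fun γ a ha hχ => ⟨τ, P, hP, hτ γ a ha fun g => ?_⟩,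
    fun _ j hj hχ => ⟨τ, P, hP, fun γ => hτ γ.toRingEquiv (j γ) (hj γ) fun g => ?_⟩⟩
  · exact (algebraMap K (AlgebraicClosure K)).injective ((hx _).symm.trans (hχ g _ (hx g)))
  · exact (algebraMap K (AlgebraicClosure K)).injective ((hx _).symm.trans (hχ γ g _ (hx g)))
end
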